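/- arXiv:math/0411117 — 5 statements merged into one kernel-verified Lean document; each statement's English description precedes it below -/
import Mathlib

section
/- Let (Q, ≤) be a bqo with only countably many ≡-equivalence classes. Then Q^ω, the set of ω-sequences of elements of Q quasi-ordered by ⟨p_n : n<ω⟩ ≤ ⟨q_n : n<ω⟩ iff there is a strictly increasing h : ω → ω with p_n ≤ q_{h(n)} for all n, has only countably many ≡-equivalence classes. -/
open Set Filter Topology

/-- A `Q`-labeled countable closed linear ordering (`Q`-cclo): a function whose
domain is a countable closed subset of `ℝ` and whose values lie in `Q`. -/
structure QCclo (Q : Type) where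
  dom : Set ℝ
  dom_countable : dom.Countable
  dom_closed : IsClosed dom
  val : ℝ → Q

/-- `h` is a strictly monotone continuous (smc-) embedding of `V₁` into `V₂`. -/
def IsSmcEmbedding (V₁ V₂ : Set ℝ) (h : ℝ → ℝ) : Prop :=
  (∀ x ∈ V₁, h x ∈ V₂) ∧
  (∀ x ∈ V₁, ∀ y ∈ V₁, x < y → h x < h y) ∧
  ContinuousOn h V₁

/-- `A ⪯ B`: there is an smc-embedding of `dom A` into `dom B` increasing labels. -/
def QCclo.Emb {Q : Type} [Preorder Q] (A B : QCclo Q) : Prop :=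
  ∃ h : ℝ → ℝ, IsSmcEmbedding A.dom B.dom h ∧ ∀ a ∈ A.dom, A.val a ≤ B.val (h a)

/-- Bi-embeddability of `Q`-cclos. -/
def QCclo.Equiv {Q : Type} [Preorder Q] (A B : QCclo Q) : Prop :=
  QCclo.Emb A B ∧ QCclo.Emb B A

/-- `A < B` for domains: one of them is empty, or they are separated
by an open interval (here witnessed by a point strictly between them). -/
def DomLt (A B : Set ℝ) : Prop :=
  A = ∅ ∨ B = ∅ ∨ ∃ c : ℝ, (∀ a ∈ A, a < c) ∧ ∀ b ∈ B, c < b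

/-- `L` is the sum `L₀ + L₁ + ⋯ + p + ⋯ + ¹L + ⁰L` (with `Ls n = L_n`,
`Rs n = ⁿL`, central point `x` labeled `p`). -/
def IsOmegaSum {Q : Type} (L : QCclo Q) (Ls Rs : ℕ → QCclo Q) (p : Q) (x : ℝ) : Prop :=
  ((∀ n, (Ls n).dom = ∅) ∨ ∀ n, (Ls n).dom.Nonempty) ∧
  ((∀ n, (Rs n).dom = ∅) ∨ ∀ n, (Rs n).dom.Nonempty) ∧
  (¬ ((∀ n, (Ls n).dom = ∅) ∧ ∀ n, (Rs n).dom = ∅)) ∧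
  (∀ n, DomLt (Ls n).dom (Ls (n+1)).dom) ∧
  (∀ n, DomLt (Ls (n+1)).dom (Rs (n+1)).dom) ∧
  (∀ n, DomLt (Rs (n+1)).dom (Rs n).dom) ∧
  (∀ a : ℕ → ℝ, (∀ n, a n ∈ (Ls n).dom) → Tendsto a atTop (𝓝 x)) ∧
  (∀ a : ℕ → ℝ, (∀ n, a n ∈ (Rs n).dom) → Tendsto a atTop (𝓝 x)) ∧
  L.dom = (⋃ n, (Ls n).dom) ∪ {x} ∪ ⋃ n, (Rs n).dom ∧
  (∀ n, ∀ y ∈ (Ls n).dom, L.val y = (Ls n).val y) ∧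
  (∀ n, ∀ y ∈ (Rs n).dom, L.val y = (Rs n).val y) ∧
  L.val x = p

/-- `L` is the finite sum `L₁ + ⋯ + L_n` of the nonempty `Q`-cclos `Ls 0, …, Ls (n-1)`. -/
def IsFinSum {Q : Type} (L : QCclo Q) (n : ℕ) (Ls : Fin n → QCclo Q) : Prop :=
  0 < n ∧ (∀ i, (Ls i).dom.Nonempty) ∧
  (∀ i j : Fin n, i < j → ∀ a ∈ (Ls i).dom, ∀ b ∈ (Ls j).dom, a < b) ∧
  L.dom = ⋃ i, (Ls i).dom ∧
  ∀ i, ∀ y ∈ (Ls i).dom, L.val y = (Ls i).val y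

/-- `S(𝒪)`: finite sums and ω-sums of members of `𝒪`. -/
def SSum {Q : Type} (O : Set (QCclo Q)) : Set (QCclo Q) :=
  {L | (∃ n Ls, IsFinSum L n Ls ∧ ∀ i, Ls i ∈ O) ∨
       ∃ Ls Rs p x, IsOmegaSum L Ls Rs p x ∧ (∀ n, Ls n ∈ O) ∧ ∀ n, Rs n ∈ O}

/-- `S'(𝒪)`: unbounded ω-sums of members of `𝒪`. -/
def S'Sum {Q : Type} [Preorder Q] (O : Set (QCclo Q)) : Set (QCclo Q) :=
  {L | ∃ Ls Rs p x, IsOmegaSum L Ls Rs p x ∧ (∀ n, Ls n ∈ O) ∧ (∀ n, Rs n ∈ O) ∧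
       (∀ n, ∃ k > n, QCclo.Emb (Ls n) (Ls k)) ∧
       ∀ n, ∃ k > n, QCclo.Emb (Rs n) (Rs k)}

/-- The hierarchy `C_α`: `C₀` = empty/singleton domains, `C_{α+1} = S(C_α) ∪ C_α`,
unions at limits. -/
noncomputable def CFam (Q : Type) [Preorder Q] : Ordinal → Set (QCclo Q) := fun α =>
  Ordinal.limitRecOn α
    {L : QCclo Q | L.dom = ∅ ∨ ∃ x : ℝ, L.dom = {x}}
    (fun _ C => SSum C ∪ C)
    (fun _ _ ih => ⋃ (β : Ordinal) (h : β < _), ih β h)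

/-- The hierarchy `C'_α`: `C'₀` = empty/singleton domains, `C'_{α+1} = S'(C'_α) ∪ C'_α`,
unions at limits. -/
noncomputable def CFam' (Q : Type) [Preorder Q] : Ordinal → Set (QCclo Q) := fun α =>
  Ordinal.limitRecOn α
    {L : QCclo Q | L.dom = ∅ ∨ ∃ x : ℝ, L.dom = {x}}
    (fun _ C => S'Sum C ∪ C)
    (fun _ _ ih => ⋃ (β : Ordinal) (h : β < _), ih β h)

/-- A sequence is good for `r` iff `r (f n) (f k)` for some `n < k`;
`r` is a wqo on `S` iff every sequence in `S` is good. -/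
def IsWqoOn {P : Type*} (r : P → P → Prop) (S : Set P) : Prop :=
  ∀ f : ℕ → P, (∀ n, f n ∈ S) → ∃ n k, n < k ∧ r (f n) (f k)

/-- `d` extends the finite set `c`: `c = {i ∈ d : i ≤ max c}`. -/
def SExtends (d : Set ℕ) (c : Finset ℕ) : Prop :=
  (c : Set ℕ) = {i ∈ d | ∃ m ∈ c, i ≤ m}

/-- `B` is a block: an infinite set of finite subsets of `ℕ` such that every infinite
subset of `⋃ B` has an initial segment in `B`. -/
def IsBlock (B : Set (Finset ℕ)) : Prop :=
  B.Infinite ∧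
  ∀ X : Set ℕ, X.Infinite → X ⊆ (⋃ b ∈ B, (b : Set ℕ)) → ∃ b ∈ B, SExtends X b

/-- A barrier: a block with no two elements comparable under inclusion. -/
def IsBarrier (B : Set (Finset ℕ)) : Prop :=
  IsBlock B ∧ ∀ b₁ ∈ B, ∀ b₂ ∈ B, b₁ ≠ b₂ → ¬ b₁ ⊆ b₂

/-- Precedence `b₁ ◁ b₂`: there are `i₁ < i₂ < ⋯ < i_m` with `b₁ = {i₁,…,i_k}`,
`b₂ = {i₂,…,i_m}`, `1 ≤ k < m`. -/
def BarrierPrec (b₁ b₂ : Finset ℕ) : Prop :=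
  ∃ (m k : ℕ) (i : ℕ → ℕ), 1 ≤ k ∧ k < m ∧
    StrictMonoOn i (Set.Icc 1 m) ∧
    b₁ = (Finset.Icc 1 k).image i ∧ b₂ = (Finset.Icc 2 m).image i

/-- `f : B → P` is bad: `¬ r (f b₁) (f b₂)` whenever `b₁ ◁ b₂` in `B`. -/
def IsBadOn {P : Type*} (r : P → P → Prop) (B : Set (Finset ℕ)) (f : Finset ℕ → P) : Prop :=
  ∀ b₁ ∈ B, ∀ b₂ ∈ B, BarrierPrec b₁ b₂ → ¬ r (f b₁) (f b₂)

/-- `r` is a bqo on `S`: every function from a barrier into `S` is good. -/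
def IsBqoOn {P : Type*} (r : P → P → Prop) (S : Set P) : Prop :=
  ∀ B : Set (Finset ℕ), IsBarrier B → ∀ f : Finset ℕ → P,
    (∀ b ∈ B, f b ∈ S) → ¬ IsBadOn r B f

/-- `r` is a bqo: every function from a barrier into `P` is good. -/
def IsBqo {P : Type*} (r : P → P → Prop) : Prop :=
  ∀ B : Set (Finset ℕ), IsBarrier B → ∀ f : Finset ℕ → P, ¬ IsBadOn r B f

/-- The quasi-order on `ω`-sequences: `p ≤ q` iff there is a strictly increasing
`h : ω → ω` with `p n ≤ q (h n)` for all `n`. -/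
def SeqLe {Q : Type} [Preorder Q] (p q : ℕ → Q) : Prop :=
  ∃ h : ℕ → ℕ, StrictMono h ∧ ∀ n, p n ≤ q (h n)

/-- The singletons form a barrier, so a bqo is a wqo. -/
theorem IsBqo.exists_lt_rel {P : Type*} {r : P → P → Prop} (h : IsBqo r) (f : ℕ → P) :
    ∃ m n, m < n ∧ r (f m) (f n) := by
  by_contra! hf
  refine h (Set.range fun n : ℕ => ({n} : Finset ℕ)) ⟨⟨?_, ?_⟩, ?_⟩ (fun b => f (b.sup id)) ?_
  · exact Set.infinite_range_of_injective Finset.singleton_injective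
  · intro X hX _
    refine ⟨{sInf X}, ⟨sInf X, rfl⟩, ?_⟩
    ext i
    simp only [Finset.coe_singleton, Set.mem_singleton_iff, Finset.mem_singleton,
      exists_eq_left, Set.mem_ofPred_eq]
    constructor
    · rintro rfl
      exact ⟨Nat.sInf_mem hX.nonempty, le_rfl⟩
    · rintro ⟨hi, hle⟩
      exact le_antisymm hle (Nat.sInf_le hi)
  · rintro _ ⟨m, rfl⟩ _ ⟨n, rfl⟩ hne hsub
    simp_all
  · rintro _ ⟨a, rfl⟩ _ ⟨b, rfl⟩ ⟨m, k, i, hk, hkm, hi, ha, hb⟩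
    have h1 : i 1 ∈ ({a} : Finset ℕ) := ha.symm.subset (Finset.mem_image_of_mem i (by simp; omega))
    have h2 : i 2 ∈ ({b} : Finset ℕ) := hb.symm.subset (Finset.mem_image_of_mem i (by simp; omega))
    rw [Finset.mem_singleton] at h1 h2
    have h12 : i 1 < i 2 :=
      hi (Set.mem_Icc.2 ⟨le_rfl, by omega⟩) (Set.mem_Icc.2 ⟨by omega, by omega⟩) one_lt_two
    simpa using hf a b (by omega)

/-- In a wqo, every subset has a finite subset below all of its elements. -/
theorem exists_finset_subset_forall_exists_le {α : Type*} [Preorder α]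
    (hwqo : ∀ f : ℕ → α, ∃ m n, m < n ∧ f m ≤ f n) (U : Set α) :
    ∃ F : Finset α, (∀ u ∈ F, u ∈ U) ∧ ∀ x ∈ U, ∃ u ∈ F, u ≤ x := by
  by_contra! hU
  obtain ⟨f, -, hf⟩ := exists_seq_of_forall_finset_exists (· ∈ U) (fun x y => ¬ x ≤ y) hU
  obtain ⟨m, n, hmn, hle⟩ := hwqo f
  exact hf m n hmn hle

/-- In a wqo, every sequence is eventually regular: all its terms from some point on
lie below infinitely many terms. -/
theorem exists_forall_ge_frequently_le {α : Type*} [Preorder α]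
    (hwqo : ∀ f : ℕ → α, ∃ m n, m < n ∧ f m ≤ f n) (f : ℕ → α) :
    ∃ N, ∀ n ≥ N, ∃ᶠ k in atTop, f n ≤ f k := by
  by_contra! hf
  have hbad : ∃ᶠ n in atTop, ¬ ∃ᶠ k in atTop, f n ≤ f k := frequently_atTop.2 fun N => by
    obtain ⟨n, hn, h⟩ := hf N
    exact ⟨n, hn, by simpa [Filter.Frequently] using h⟩
  obtain ⟨φ, hφ, hφbad⟩ := extraction_of_frequently_atTop hbad
  have : WellQuasiOrdered ((· ≤ ·) : α → α → Prop) := fun g => hwqo g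
  obtain ⟨g, hg⟩ := this.exists_monotone_subseq (f ∘ φ)
  refine hφbad (g 0) (frequently_atTop.2 fun M => ⟨φ (g M), ?_, hg 0 M (Nat.zero_le M)⟩)
  exact (g.strictMono.le_apply).trans hφ.le_apply

theorem seqLe_of_forall_lt_of_forall_ge {Q : Type} [Preorder Q] {f g : ℕ → Q} {N : ℕ}
    (hlt : ∀ n < N, f n ≤ g n) (hge : ∀ n ≥ N, ∃ᶠ k in atTop, f n ≤ g k) : SeqLe f g := by
  obtain ⟨φ, hφ, hle⟩ := extraction_forall_of_frequently
    (P := fun n k => N ≤ k ∧ f (N + n) ≤ g k)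
    fun n => ((hge (N + n) (Nat.le_add_right N n)).and_eventually
      (eventually_ge_atTop N)).mono fun _ h => h.symm
  refine ⟨fun n => if n < N then n else φ (n - N), fun m n hmn => ?_, fun n => ?_⟩
  · dsimp only
    split_ifs with hm hn hn
    · exact hmn
    · exact hm.trans_le (hle _).1
    · omega
    · exact hφ (by omega)
  · dsimp only
    split_ifs with hn
    · exact hlt n hn
    · simpa [Nat.add_sub_cancel' (not_lt.1 hn)] using (hle (n - N)).2

/-- If `Q` is a bqo with only countably many `≡`-classes, then `Q^ω` has only
countably many `≡`-classes. -/
theorem stmt8 (Q : Type) [Preorder Q]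
    (hbqo : IsBqo (fun p q : Q => p ≤ q))
    (hcount : ∃ S : Set Q, S.Countable ∧ ∀ q : Q, ∃ s ∈ S, q ≤ s ∧ s ≤ q) :
    ∃ T : Set (ℕ → Q), T.Countable ∧
      ∀ f : ℕ → Q, ∃ g ∈ T, SeqLe f g ∧ SeqLe g f := by
  obtain ⟨S, hS, hrep⟩ := hcount
  have := hS.to_subtype
  choose rep hmem hle hge using hrep
  have hwqo : ∀ f : ℕ → S, ∃ m n, m < n ∧ f m ≤ f n := fun f =>
    hbqo.exists_lt_rel fun n => (f n : Q)
  choose N hN using exists_forall_ge_frequently_le (α := Q) hbqo.exists_lt_rel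
  choose F hFmem hFle using fun f : ℕ → Q =>
    exists_finset_subset_forall_exists_le hwqo {s : S | ∀ n ≥ N f, ¬ (s : Q) ≤ f n}
  let code : (ℕ → Q) → List S × Finset S := fun f =>
    ((List.range (N f)).map fun n => ⟨rep (f n), hmem (f n)⟩, F f)
  have key : ∀ f g, code f = code g → SeqLe f g := by
    intro f g hfg
    obtain ⟨hl, hF⟩ := Prod.ext_iff.1 hfg
    dsimp only [code] at hl hF
    have hlen : N f = N g := by simpa using congrArg List.length hl
    rw [← hlen] at hl
    refine seqLe_of_forall_lt_of_forall_ge (N := N f) (fun n hn => ?_) fun n hn => ?_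
    · have heq := Subtype.ext_iff.1 (List.map_inj_left.1 hl n (List.mem_range.2 hn))
      exact (hle (f n)).trans (heq.le.trans (hge (g n)))
    · by_cases h : ∃ k ≥ N g, rep (f n) ≤ g k
      · obtain ⟨k, hk, hkle⟩ := h
        exact (hN g k hk).mono fun _ h => (hle (f n)).trans (hkle.trans h)
      · push Not at h
        obtain ⟨u, hu, hule⟩ := hFle g ⟨rep (f n), hmem (f n)⟩ h
        exact (hFmem f u (hF ▸ hu) n hn (le_trans hule (hge (f n)))).elim
  refine ⟨Set.range fun x : Set.range code => x.2.choose, Set.countable_range _, fun f => ?_⟩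
  have hf : code (Set.mem_range_self (f := code) f).choose = code f :=
    (Set.mem_range_self (f := code) f).choose_spec
  exact ⟨_, ⟨⟨code f, f, rfl⟩, rfl⟩, key _ _ hf.symm, key _ _ hf⟩
end

section
/- Let Q be a countable bqo and let O be a set of Q-cclos such that O/≡ is countable (where A ≡ B iff A ⪯ B and B ⪯ A). Then both S'(O)/≡ and S(O)/≡ are countable. -/
open Set Filter Topology

/-! ### Ramsey's theorem for locally determined colourings -/

/-- `f` restricted to the infinite subsets of `H` is determined by finite initial segments. -/
def LocallyDetermined {C : Type*} (H : Set ℕ) (f : Set ℕ → C) : Prop :=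
  ∀ X ⊆ H, X.Infinite → ∃ n, ∀ Y ⊆ H, Y.Infinite → X ∩ Iio n = Y ∩ Iio n → f Y = f X

/-- The colour of `s ∪ X`, for infinite `X ⊆ H` beyond `k`, is found by reading off finitely many
elements of `X`. -/
inductive Decided {C : Type*} (H : Set ℕ) (f : Set ℕ → C) : Set ℕ → ℕ → Prop
  | const (s : Set ℕ) (k : ℕ) (c : C)
      (h : ∀ X ⊆ H ∩ Ici k, X.Infinite → f (s ∪ X) = c) : Decided H f s k
  | step (s : Set ℕ) (k : ℕ)
      (h : ∀ n ∈ H, k ≤ n → Decided H f (insert n s) (n + 1)) : Decided H f s k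

theorem LocallyDetermined.decided {C : Type*} {H : Set ℕ} {f : Set ℕ → C}
    (hf : LocallyDetermined H f) : Decided H f ∅ 0 := by
  by_contra h0
  have key : ∀ p : {p : Set ℕ × ℕ // ¬ Decided H f p.1 p.2},
      ∃ n ∈ H, p.1.2 ≤ n ∧ ¬ Decided H f (insert n p.1.1) (n + 1) := by
    rintro ⟨⟨s, k⟩, hp⟩
    by_contra! h
    exact hp (Decided.step s k h)
  choose nx hnH hnk hnD using key
  let st : ℕ → {p : Set ℕ × ℕ // ¬ Decided H f p.1 p.2} := fun i =>
    Nat.rec ⟨(∅, 0), h0⟩ (fun _ p => ⟨(insert (nx p) p.1.1, nx p + 1), hnD p⟩) i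
  let a : ℕ → ℕ := fun i => nx (st i)
  have hst : ∀ i, (st (i + 1)).1 = (insert (a i) (st i).1.1, a i + 1) := fun i => rfl
  have ha : StrictMono a := strictMono_nat_of_lt_succ fun i => by
    have := hnk (st (i + 1))
    rw [hst] at this
    exact this
  have hs : ∀ i, (st i).1.1 = a '' Iio i := by
    intro i
    induction i with
    | zero => simp [st]
    | succ i ih =>
      have hins : insert i (Iio i) = Iio (i + 1) := by
        ext j
        simp only [mem_insert_iff, mem_Iio]
        omega
      rw [hst, ih, ← image_insert_eq, hins]
  obtain ⟨N, hN⟩ := hf (range a) (by rintro _ ⟨i, rfl⟩; exact hnH _)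
    (infinite_range_of_injective ha.injective)
  have h2 : ¬ Decided H f (a '' Iio (N + 1)) (a N + 1) := by
    rw [← hs]
    exact (st (N + 1)).2
  apply h2
  refine Decided.const _ _ (f (range a)) fun X hX hXi => hN _ ?_ (hXi.mono subset_union_right) ?_
  · rintro y (⟨i, _, rfl⟩ | hy)
    · exact hnH _
    · exact (hX hy).1
  · have hNa : N ≤ a N := ha.id_le N
    ext y
    simp only [mem_inter_iff, mem_range, mem_Iio, mem_union, mem_image]
    constructor
    · rintro ⟨⟨i, rfl⟩, hi⟩
      refine ⟨Or.inl ⟨i, ?_, rfl⟩, hi⟩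
      have := ha.id_le i
      simp only [id] at this
      omega
    · rintro ⟨⟨i, _, rfl⟩ | hy, hi⟩
      · exact ⟨⟨i, rfl⟩, hi⟩
      · have := (hX hy).2
        simp only [mem_Ici] at this
        omega

theorem Decided.homogeneous {C : Type*} [Finite C] {H : Set ℕ} {f : Set ℕ → C} {s : Set ℕ} {k : ℕ}
    (hd : Decided H f s k) : ∀ G ⊆ H ∩ Ici k, G.Infinite →
      ∃ K ⊆ G, K.Infinite ∧ ∃ c, ∀ X ⊆ K, X.Infinite → f (s ∪ X) = c := by
  induction hd with
  | const s k c h =>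
    exact fun G hG hGi => ⟨G, Subset.rfl, hGi, c, fun X hX => h X (hX.trans hG)⟩
  | step s k h ih =>
    intro G hG hGi
    have key : ∀ D : {D : Set ℕ // D ⊆ H ∩ Ici k ∧ D.Infinite},
        ∃ E : {D : Set ℕ // D ⊆ H ∩ Ici k ∧ D.Infinite}, ∃ c, E.1 ⊆ D.1 ∩ Ioi (sInf D.1) ∧
          ∀ X ⊆ E.1, X.Infinite → f (insert (sInf D.1) s ∪ X) = c := by
      rintro ⟨D, hD, hDi⟩
      have hm : sInf D ∈ D := Nat.sInf_mem hDi.nonempty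
      have hDinf : (D ∩ Ioi (sInf D)).Infinite := by
        have : D ∩ Ioi (sInf D) = D \ Iic (sInf D) := by ext; simp
        rw [this]
        exact hDi.sdiff (finite_Iic _)
      obtain ⟨K, hK, hKi, c, hc⟩ := ih (sInf D) (hD hm).1 (hD hm).2 (D ∩ Ioi (sInf D))
        (fun y hy => ⟨(hD hy.1).1, hy.2⟩) hDinf
      exact ⟨⟨K, fun y hy => hD (hK hy).1, hKi⟩, c, hK, hc⟩
    choose nx col hnx hcol using key
    let D : ℕ → {D : Set ℕ // D ⊆ H ∩ Ici k ∧ D.Infinite} := fun i =>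
      Nat.rec ⟨G, hG, hGi⟩ (fun _ p => nx p) i
    let a : ℕ → ℕ := fun i => sInf (D i).1
    have hD : ∀ i, (D (i + 1)).1 ⊆ (D i).1 ∩ Ioi (a i) := fun i => hnx (D i)
    have haD : ∀ i, a i ∈ (D i).1 := fun i => Nat.sInf_mem (D i).2.2.nonempty
    have hanti : Antitone fun i => (D i).1 :=
      antitone_nat_of_succ_le fun i => (hD i).trans inter_subset_left
    have ha : StrictMono a := strictMono_nat_of_lt_succ fun i => (hD i (haD (i + 1))).2
    obtain ⟨c, hc⟩ := Finite.exists_infinite_fiber (fun i => col (D i))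
    rw [Set.infinite_coe_iff] at hc
    refine ⟨a '' ((fun i => col (D i)) ⁻¹' {c}), ?_, hc.image ha.injective.injOn, c, ?_⟩
    · rintro _ ⟨i, _, rfl⟩
      exact hanti (Nat.zero_le i) (haD i)
    · intro X hX hXi
      obtain ⟨i, hi, hiX⟩ := hX (Nat.sInf_mem hXi.nonempty)
      have hsub : X \ {a i} ⊆ (D (i + 1)).1 := by
        rintro y ⟨hy, hya⟩
        obtain ⟨j, _, rfl⟩ := hX hy
        have h1 : a i ≤ a j := hiX ▸ Nat.sInf_le hy
        have h2 : i < j := ha.lt_iff_lt.1 (lt_of_le_of_ne h1 fun h => hya h.symm)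
        exact hanti h2 (haD j)
      have := hcol (D i) (X \ {a i}) hsub (hXi.sdiff (finite_singleton _))
      have hXe : s ∪ X = insert (a i) s ∪ (X \ {a i}) := by
        have : a i ∈ X := hiX ▸ Nat.sInf_mem hXi.nonempty
        ext y
        by_cases hy : y = a i <;> simp [hy, this]
      rw [hXe]
      exact this.trans hi

theorem LocallyDetermined.exists_homogeneous {C : Type*} [Finite C] {H : Set ℕ} (hH : H.Infinite)
    {f : Set ℕ → C} (hf : LocallyDetermined H f) :
    ∃ K ⊆ H, K.Infinite ∧ ∃ c, ∀ X ⊆ K, X.Infinite → f X = c := by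
  simpa using hf.decided.homogeneous H (by simp) hH

/-! ### Minimal bad arrays -/

/-- `X` without its least element. -/
def shift (X : Set ℕ) : Set ℕ := X \ {sInf X}

theorem shift_subset (X : Set ℕ) : shift X ⊆ X := sdiff_subset

theorem shift_infinite {X : Set ℕ} (hX : X.Infinite) : (shift X).Infinite :=
  hX.sdiff (finite_singleton _)

theorem sInf_lt_of_mem_shift {X : Set ℕ} {y : ℕ} (hy : y ∈ shift X) : sInf X < y :=
  lt_of_le_of_ne (Nat.sInf_le hy.1) fun h => hy.2 h.symm

/-- The successor of the least element of `X` that is at least `k`. -/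
noncomputable def roundUp (X : Set ℕ) (k : ℕ) : ℕ := sInf (X ∩ Ici k) + 1

theorem sInf_inter_Ici_mem {X : Set ℕ} (hX : X.Infinite) (k : ℕ) :
    sInf (X ∩ Ici k) ∈ X ∩ Ici k := by
  obtain ⟨y, hy, hk⟩ := hX.exists_gt k
  exact Nat.sInf_mem ⟨y, hy, hk.le⟩

theorem exists_roundUp_eq {X : Set ℕ} (hX : X.Infinite) (k : ℕ) :
    ∃ x ∈ X, roundUp X k = x + 1 :=
  ⟨_, (sInf_inter_Ici_mem hX k).1, rfl⟩

theorem lt_roundUp {X : Set ℕ} (hX : X.Infinite) (k : ℕ) : k < roundUp X k :=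
  Nat.lt_succ_of_le (sInf_inter_Ici_mem hX k).2

theorem inter_Iio_mono {X Y : Set ℕ} {n k : ℕ} (hk : k ≤ n) (h : X ∩ Iio n = Y ∩ Iio n) :
    X ∩ Iio k = Y ∩ Iio k := by
  have : Iio k = Iio n ∩ Iio k := by ext; simp; omega
  rw [this, ← inter_assoc, h, inter_assoc]

theorem mem_of_inter_Iio_eq {X Y : Set ℕ} {n y : ℕ} (h : X ∩ Iio n = Y ∩ Iio n) (hy : y ∈ X)
    (hn : y < n) : y ∈ Y :=
  (h ▸ (⟨hy, hn⟩ : y ∈ X ∩ Iio n) : y ∈ Y ∩ Iio n).1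

theorem roundUp_congr {X Y : Set ℕ} {k : ℕ} (hX : X.Infinite)
    (h : X ∩ Iio (roundUp X k) = Y ∩ Iio (roundUp X k)) : roundUp Y k = roundUp X k := by
  have hx := sInf_inter_Ici_mem hX k
  have hxY : sInf (X ∩ Ici k) ∈ Y := mem_of_inter_Iio_eq h hx.1 (Nat.lt_succ_self _)
  have h1 : sInf (Y ∩ Ici k) ≤ sInf (X ∩ Ici k) := Nat.sInf_le ⟨hxY, hx.2⟩
  have hy : sInf (Y ∩ Ici k) ∈ Y ∩ Ici k := Nat.sInf_mem ⟨_, hxY, hx.2⟩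
  have hyX : sInf (Y ∩ Ici k) ∈ X := mem_of_inter_Iio_eq h.symm hy.1 (Nat.lt_succ_of_le h1)
  have h2 : sInf (X ∩ Ici k) ≤ sInf (Y ∩ Ici k) := Nat.sInf_le ⟨hyX, hy.2⟩
  unfold roundUp
  omega

theorem shift_inter_Iio_eq {X Y : Set ℕ} {n : ℕ} (hX : X.Nonempty) (hn : sInf X < n)
    (h : X ∩ Iio n = Y ∩ Iio n) : shift X ∩ Iio n = shift Y ∩ Iio n := by
  have hm : sInf X = sInf Y := by
    have hXY : sInf X ∈ Y := mem_of_inter_Iio_eq h (Nat.sInf_mem hX) hn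
    have h1 : sInf Y ≤ sInf X := Nat.sInf_le hXY
    exact le_antisymm (Nat.sInf_le (mem_of_inter_Iio_eq h.symm (Nat.sInf_mem ⟨_, hXY⟩)
      (h1.trans_lt hn))) h1
  unfold shift
  rw [sdiff_inter_right_comm, h, hm, sdiff_inter_right_comm]

/-- A bad array on the infinite subsets `X` of `H`; the value `f X` is determined by the
initial segment `X ∩ Iio (m X)` of `X`. -/
structure BadArray {T : Type*} (R : T → T → Prop) where
  H : Set ℕ
  infinite : H.Infinite
  f : Set ℕ → T
  m : Set ℕ → ℕ
  mem : ∀ X ⊆ H, X.Infinite → ∃ x ∈ X, m X = x + 1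
  loc : ∀ X ⊆ H, X.Infinite → ∀ Y ⊆ H, Y.Infinite → X ∩ Iio (m X) = Y ∩ Iio (m X) →
    f Y = f X ∧ m Y = m X
  bad : ∀ X ⊆ H, X.Infinite → ¬ R (f X) (f (shift X))

namespace BadArray

variable {T : Type*} {R : T → T → Prop} {lt : T → T → Prop}

/-- `q` is a refinement of `p`: values may only be lowered, and lowering a value is accompanied
by an increase of the initial segment which determines it. -/
def Refines (lt : T → T → Prop) (q p : BadArray R) : Prop :=
  q.H ⊆ p.H ∧ ∀ X ⊆ q.H, X.Infinite →
    (q.f X = p.f X ∧ q.m X = p.m X) ∨ (lt (q.f X) (p.f X) ∧ p.m X < q.m X)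

theorem Refines.rfl' {p : BadArray R} : p.Refines lt p :=
  ⟨Subset.rfl, fun _ _ _ => Or.inl ⟨rfl, rfl⟩⟩

theorem Refines.trans (ht : ∀ a b c, lt a b → lt b c → lt a c) {r q p : BadArray R}
    (h : r.Refines lt q) (h' : q.Refines lt p) : r.Refines lt p := by
  refine ⟨h.1.trans h'.1, fun X hX hXi => ?_⟩
  rcases h.2 X hX hXi with ⟨h1, h2⟩ | ⟨h1, h2⟩ <;>
    rcases h'.2 X (hX.trans h.1) hXi with ⟨h3, h4⟩ | ⟨h3, h4⟩
  · exact Or.inl ⟨h1.trans h3, h2.trans h4⟩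
  · exact Or.inr ⟨h1 ▸ h3, h2 ▸ h4⟩
  · exact Or.inr ⟨h3 ▸ h1, h4 ▸ h2⟩
  · exact Or.inr ⟨ht _ _ _ h1 h3, h4.trans h2⟩

theorem Refines.le_m {q p : BadArray R} (h : q.Refines lt p) {X : Set ℕ} (hX : X ⊆ q.H)
    (hXi : X.Infinite) : p.m X ≤ q.m X := by
  rcases h.2 X hX hXi with ⟨_, h2⟩ | ⟨_, h2⟩
  exacts [h2.ge, h2.le]

/-- No refinement with the same elements below `N` changes values determined below `N`. -/
def Stable (lt : T → T → Prop) (q : BadArray R) (N : ℕ) : Prop :=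
  ∀ r : BadArray R, r.Refines lt q → r.H ∩ Iio N = q.H ∩ Iio N →
    ∀ X ⊆ r.H, X.Infinite → q.m X ≤ N → r.m X = q.m X

theorem Stable.of_refines (ht : ∀ a b c, lt a b → lt b c → lt a c) {q p : BadArray R} {N : ℕ}
    (hp : p.Stable lt N) (h : q.Refines lt p) (hN : q.H ∩ Iio N = p.H ∩ Iio N) :
    q.Stable lt N := by
  intro r hr hrN X hX hXi hm
  have h1 := hp r (hr.trans ht h) (hrN.trans hN) X hX hXi
    ((h.le_m (hX.trans hr.1) hXi).trans hm)
  have h2 := h.le_m (hX.trans hr.1) hXi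
  have h3 := hr.le_m hX hXi
  omega

theorem min_m_congr (p : BadArray R) {N : ℕ} {X Y : Set ℕ} (hX : X ⊆ p.H) (hXi : X.Infinite)
    (hY : Y ⊆ p.H) (hYi : Y.Infinite) (h : X ∩ Iio N = Y ∩ Iio N) :
    min (N + 1) (p.m X) = min (N + 1) (p.m Y) := by
  by_cases h1 : p.m X ≤ N
  · rw [(p.loc X hX hXi Y hY hYi (inter_Iio_mono h1 h)).2]
  · by_cases h2 : p.m Y ≤ N
    · rw [(p.loc Y hY hYi X hX hXi (inter_Iio_mono h2 h.symm)).2]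
    · omega

open Classical in
/-- A measure of how far the initial segments determining the values of `p` are known to reach
beyond the subsets of `Iio N`. -/
noncomputable def potential (p : BadArray R) (N : ℕ) : ℕ :=
  ∑ t ∈ (Finset.range N).powerset,
    if (t : Set ℕ) ⊆ p.H then min (N + 1) (p.m (t ∪ p.H \ Iio N)) else 0

theorem exists_stable (ht : ∀ a b c, lt a b → lt b c → lt a c) (p : BadArray R) (N : ℕ) :
    ∃ q : BadArray R, q.Refines lt p ∧ q.H ∩ Iio N = p.H ∩ Iio N ∧ q.Stable lt N := by
  classical
  have hb : ∀ q : BadArray R, q.potential N ≤ ∑ t ∈ (Finset.range N).powerset, (N + 1) := by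
    intro q
    refine Finset.sum_le_sum fun t _ => ?_
    split_ifs
    exacts [min_le_left _ _, Nat.zero_le _]
  set B := ∑ t ∈ (Finset.range N).powerset, (N + 1) with hB
  obtain ⟨q, ⟨hq, hqN⟩, hmin⟩ := (measure fun q : BadArray R => B - q.potential N).wf.has_min
    {q | q.Refines lt p ∧ q.H ∩ Iio N = p.H ∩ Iio N} ⟨p, Refines.rfl', rfl⟩
  refine ⟨q, hq, hqN, fun r hr hrN X hX hXi hm => ?_⟩
  by_contra hne
  have hsub : ∀ t ∈ (Finset.range N).powerset, ((t : Set ℕ) ⊆ r.H ↔ (t : Set ℕ) ⊆ q.H) := by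
    intro t htN
    have htN' : (t : Set ℕ) ⊆ Iio N := fun y hy =>
      Finset.mem_range.1 (Finset.mem_powerset.1 htN hy)
    exact ⟨fun h => h.trans hr.1, fun h y hy =>
      mem_of_inter_Iio_eq hrN.symm (h hy) (htN' hy)⟩
  have hinf : ∀ (t : Set ℕ) (s : BadArray R), (t ∪ s.H \ Iio N).Infinite := fun t s =>
    (s.infinite.sdiff (finite_Iio N)).mono subset_union_right
  have htr : ∀ t ∈ (Finset.range N).powerset,
      ((t : Set ℕ) ∪ q.H \ Iio N) ∩ Iio N = ((t : Set ℕ) ∪ r.H \ Iio N) ∩ Iio N := by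
    intro t _
    ext y
    simp only [mem_inter_iff, mem_union, Set.mem_sdiff, mem_Iio]
    tauto
  have hle : ∀ t ∈ (Finset.range N).powerset, (t : Set ℕ) ⊆ r.H →
      min (N + 1) (q.m (t ∪ q.H \ Iio N)) = min (N + 1) (q.m (t ∪ r.H \ Iio N)) ∧
      q.m (t ∪ r.H \ Iio N) ≤ r.m (t ∪ r.H \ Iio N) := by
    intro t htN h
    have h1 : (t : Set ℕ) ∪ r.H \ Iio N ⊆ r.H := union_subset h sdiff_subset
    exact ⟨q.min_m_congr (union_subset (h.trans hr.1) sdiff_subset) (hinf _ _) (h1.trans hr.1)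
      (hinf _ _) (htr t htN), hr.le_m h1 (hinf _ _)⟩
  have hlt : q.potential N < r.potential N := by
    refine Finset.sum_lt_sum (fun t htN => ?_) ⟨(Finset.range N).filter (· ∈ X), by simp, ?_⟩
    · by_cases h : (t : Set ℕ) ⊆ r.H
      · rw [if_pos h, if_pos ((hsub t htN).1 h)]
        have := hle t htN h
        omega
      · rw [if_neg h, if_neg fun h' => h ((hsub t htN).2 h')]
    · have htN : (Finset.range N).filter (· ∈ X) ∈ (Finset.range N).powerset := by simp
      set t := (Finset.range N).filter (· ∈ X) with htdef
      have h : (t : Set ℕ) ⊆ r.H := fun y hy => hX (Finset.mem_filter.1 hy).2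
      rw [if_pos h, if_pos ((hsub t htN).1 h)]
      have hXt : X ∩ Iio N = ((t : Set ℕ) ∪ r.H \ Iio N) ∩ Iio N := by
        ext y
        simp only [htdef, mem_inter_iff, mem_union, Set.mem_sdiff, mem_Iio, Finset.coe_filter,
          mem_ofPred_eq, Finset.mem_range]
        tauto
      have h1 : (t : Set ℕ) ∪ r.H \ Iio N ⊆ r.H := union_subset h sdiff_subset
      have h2 := r.min_m_congr hX hXi h1 (hinf _ _) hXt
      have h3 := q.min_m_congr (hX.trans hr.1) hXi (h1.trans hr.1) (hinf _ _) hXt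
      have h4 := hr.le_m hX hXi
      have := hle t htN h
      omega
  have h5 := hmin r ⟨hr.trans ht hq, hrN.trans hqN⟩
  have h6 := hb r
  exact h5 (show B - r.potential N < B - q.potential N by omega)

/-- The fusion of a sequence of successively refined bad arrays. -/
theorem exists_fusion (ht : ∀ a b c, lt a b → lt b c → lt a c) (hw : WellFounded lt)
    (P : ℕ → BadArray R) (N : ℕ → ℕ) (hN : StrictMono N)
    (hP : ∀ n, (P (n + 1)).Refines lt (P n))
    (htr : ∀ n, (P (n + 1)).H ∩ Iio (N n) = (P n).H ∩ Iio (N n))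
    (hel : ∀ n, ∃ a ∈ (P (n + 1)).H, N n ≤ a ∧ a < N (n + 1)) :
    ∃ p : BadArray R, (∀ n, p.Refines lt (P n)) ∧
      ∀ n, p.H ∩ Iio (N n) = (P n).H ∩ Iio (N n) := by
  have hle : ∀ n k, n ≤ k → (P k).Refines lt (P n) := fun n k hnk => by
    induction k, hnk using Nat.le_induction with
    | base => exact Refines.rfl'
    | succ k _ ih => exact (hP k).trans ht ih
  have htr' : ∀ n k, n ≤ k → (P k).H ∩ Iio (N n) = (P n).H ∩ Iio (N n) := fun n k hnk => by
    induction k, hnk using Nat.le_induction with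
    | base => rfl
    | succ k hk ih => exact (inter_Iio_mono (hN.monotone hk) (htr k)).trans ih
  set H : Set ℕ := ⋂ n, (P n).H with hH
  have hHP : ∀ n, H ⊆ (P n).H := fun n => iInter_subset _ n
  have hHN : ∀ n, H ∩ Iio (N n) = (P n).H ∩ Iio (N n) := by
    intro n
    refine Subset.antisymm (inter_subset_inter_left _ (hHP n)) ?_
    rintro y ⟨hy, hyN⟩
    refine ⟨mem_iInter.2 fun k => ?_, hyN⟩
    rcases le_total n k with h | h
    · exact mem_of_inter_Iio_eq (htr' n k h).symm hy hyN
    · exact (hle k n h).1 hy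
  have hinf : H.Infinite := by
    rw [Set.infinite_iff_exists_gt]
    intro b
    obtain ⟨a, ha, h1, h2⟩ := hel (b + 1)
    have := hN.id_le (b + 1)
    simp only [id] at this
    exact ⟨a, mem_of_inter_Iio_eq (hHN (b + 2)).symm ha h2, by omega⟩
  have hev : ∀ X, ∃ n, X ⊆ H → X.Infinite → ∀ k, n ≤ k →
      (P k).f X = (P n).f X ∧ (P k).m X = (P n).m X := by
    intro X
    by_cases hX : X ⊆ H ∧ X.Infinite
    · obtain ⟨_, ⟨n, rfl⟩, hmin⟩ := hw.has_min (range fun n => (P n).f X) (range_nonempty _)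
      refine ⟨n, fun _ _ k hk => ?_⟩
      rcases (hle n k hk).2 X (hX.1.trans (hHP k)) hX.2 with h | h
      · exact h
      · exact absurd h.1 (hmin _ ⟨k, rfl⟩)
    · exact ⟨0, fun h1 h2 => absurd ⟨h1, h2⟩ hX⟩
  choose ν hν using hev
  refine ⟨⟨H, hinf, fun X => (P (ν X)).f X, fun X => (P (ν X)).m X, ?_, ?_, ?_⟩, ?_, hHN⟩
  · exact fun X hX hXi => (P (ν X)).mem X (hX.trans (hHP _)) hXi
  · intro X hX hXi Y hY hYi h
    obtain ⟨h1, h2⟩ := hν X hX hXi _ (le_max_left (ν X) (ν Y))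
    obtain ⟨h3, h4⟩ := hν Y hY hYi _ (le_max_right (ν X) (ν Y))
    rw [← h2] at h
    rw [← h1, ← h2, ← h3, ← h4]
    exact (P _).loc X (hX.trans (hHP _)) hXi Y (hY.trans (hHP _)) hYi h
  · intro X hX hXi
    have hY := (shift_subset X).trans hX
    have hYi := shift_infinite hXi
    obtain ⟨h1, -⟩ := hν X hX hXi _ (le_max_left (ν X) (ν (shift X)))
    obtain ⟨h3, -⟩ := hν _ hY hYi _ (le_max_right (ν X) (ν (shift X)))
    rw [← h1, ← h3]
    exact (P _).bad X (hX.trans (hHP _)) hXi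
  · intro n
    refine ⟨hHP n, fun X hX hXi => ?_⟩
    obtain ⟨h1, h2⟩ := hν X hX hXi _ (le_max_left (ν X) n)
    rw [← h1, ← h2]
    exact (hle n _ (le_max_right _ _)).2 X (hX.trans (hHP _)) hXi

/-- If there is a bad array, there is one all of whose values determined below `x + 1` are
stable, for every `x` in its domain. -/
theorem exists_forall_stable (ht : ∀ a b c, lt a b → lt b c → lt a c) (hw : WellFounded lt)
    (p₀ : BadArray R) : ∃ p : BadArray R, ∀ x ∈ p.H, p.Stable lt (x + 1) := by
  choose st hst1 hst2 hst3 using fun (s : BadArray R × ℕ) => exists_stable (lt := lt) ht s.1 s.2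
  let S : ℕ → BadArray R × ℕ := fun n =>
    Nat.rec (p₀, 0) (fun _ s => (st s, roundUp (st s).H s.2)) n
  have hS : ∀ n, S (n + 1) = (st (S n), roundUp (st (S n)).H (S n).2) := fun n => rfl
  obtain ⟨p, hp1, hp2⟩ := exists_fusion ht hw (fun n => (S n).1) (fun n => (S n).2)
    (strictMono_nat_of_lt_succ fun n => by
      rw [hS]; exact lt_roundUp (st (S n)).infinite _)
    (fun n => hst1 (S n)) (fun n => hst2 (S n))
    (fun n => ⟨_, (sInf_inter_Ici_mem (st (S n)).infinite (S n).2).1,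
      (sInf_inter_Ici_mem (st (S n)).infinite (S n).2).2, Nat.lt_succ_self _⟩)
  refine ⟨p, fun x hx => ?_⟩
  have hex : ∃ n, x < (S n).2 := by
    have hmono : StrictMono fun n => (S n).2 := strictMono_nat_of_lt_succ fun n => by
      rw [hS]; exact lt_roundUp (st (S n)).infinite _
    exact ⟨x + 1, Nat.lt_of_succ_le (hmono.id_le (x + 1))⟩
  classical
  obtain ⟨n, hn⟩ : ∃ n, Nat.find hex = n + 1 := by
    refine Nat.exists_eq_succ_of_ne_zero fun h0 => ?_
    have := Nat.find_spec hex
    rw [h0] at this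
    exact Nat.not_lt_zero _ this
  have h1 : x < (S (n + 1)).2 := hn ▸ Nat.find_spec hex
  have h2 : (S n).2 ≤ x := not_lt.1 (Nat.find_min hex (by omega))
  have h3 : (S (n + 1)).2 = x + 1 := by
    have hxs : x ∈ (st (S n)).H ∩ Ici (S n).2 := ⟨(hp1 (n + 1)).1 hx, h2⟩
    have h4 : sInf ((st (S n)).H ∩ Ici (S n).2) ≤ x := Nat.sInf_le hxs
    have h5 : (S (n + 1)).2 = sInf ((st (S n)).H ∩ Ici (S n).2) + 1 := rfl
    omega
  rw [← h3]
  exact (hst3 (S (n + 1))).of_refines ht (hp1 (n + 2))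
    ((inter_Iio_mono (by rw [hS (n + 1)]; exact (lt_roundUp (st (S (n + 1))).infinite _).le)
      (hp2 (n + 2))))

/-- The minimal bad array lemma. -/
theorem exists_minimal (ht : ∀ a b c, lt a b → lt b c → lt a c) (hw : WellFounded lt)
    (hc : ∀ a b c, R a b → lt b c → R a c) (p₀ : BadArray R) :
    ∃ p : BadArray R, ∀ q : BadArray R, q.H ⊆ p.H →
      ¬ ∀ X ⊆ q.H, X.Infinite → lt (q.f X) (p.f X) := by
  classical
  obtain ⟨p, hp⟩ := exists_forall_stable ht hw p₀
  refine ⟨p, fun q hq hlt => ?_⟩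
  obtain ⟨X₀, ⟨hX₀, hX₀i⟩, hmin⟩ := (measure p.m).wf.has_min {X | X ⊆ q.H ∧ X.Infinite}
    ⟨q.H, Subset.rfl, q.infinite⟩
  replace hmin : ∀ X ⊆ q.H, X.Infinite → p.m X₀ ≤ p.m X := fun X h1 h2 =>
    not_lt.1 (hmin X ⟨h1, h2⟩)
  obtain ⟨x, hx, hM⟩ := p.mem X₀ (hX₀.trans hq) hX₀i
  set M := p.m X₀ with hMdef
  let K := p.H ∩ Iio M ∪ q.H
  have hK : K ⊆ p.H := union_subset inter_subset_left hq
  have hqK : ∀ X ⊆ K, ∀ Y ⊆ K, X ∩ Iio M = Y ∩ Iio M → X ⊆ q.H → Y ⊆ q.H := by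
    intro X hX Y hY h hXq y hy
    rcases hY hy with h1 | h1
    · exact hXq (mem_of_inter_Iio_eq h.symm hy h1.2)
    · exact h1
  let m' : Set ℕ → ℕ := fun X => if X ⊆ q.H then roundUp X (max (q.m X) (p.m X)) else p.m X
  let r : BadArray R :=
    { H := K
      infinite := q.infinite.mono subset_union_right
      f := fun X => if X ⊆ q.H then q.f X else p.f X
      m := m'
      mem := by
        intro X hX hXi
        by_cases h : X ⊆ q.H
        · simp only [m', if_pos h]
          exact exists_roundUp_eq hXi _
        · simp only [m', if_neg h]
          exact p.mem X (hX.trans hK) hXi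
      loc := by
        intro X hX hXi Y hY hYi hXY
        by_cases h : X ⊆ q.H
        · simp only [m', if_pos h] at hXY
          have h1 := lt_roundUp hXi (max (q.m X) (p.m X))
          have h2 := hmin X h hXi
          have hYq : Y ⊆ q.H := hqK X hX Y hY (inter_Iio_mono (by omega) hXY) h
          have h3 := q.loc X h hXi Y hYq hYi (inter_Iio_mono (by omega) hXY)
          have h4 := p.loc X (hX.trans hK) hXi Y (hY.trans hK) hYi
            (inter_Iio_mono (by omega) hXY)
          simp only [m', if_pos h, if_pos hYq, h3.1, h3.2, h4.2]
          exact ⟨trivial, roundUp_congr hXi hXY⟩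
        · simp only [m', if_neg h] at hXY
          have h4 := p.loc X (hX.trans hK) hXi Y (hY.trans hK) hYi hXY
          have hYq : ¬ Y ⊆ q.H := by
            intro hYq
            have h2 := hmin Y hYq hYi
            exact h (hqK Y hY X hX (inter_Iio_mono (by omega) hXY.symm) hYq)
          simp only [m', if_neg h, if_neg hYq]
          exact h4
      bad := by
        intro X hX hXi
        by_cases h : X ⊆ q.H
        · simp only [if_pos h, if_pos ((shift_subset X).trans h)]
          exact q.bad X h hXi
        · by_cases h' : shift X ⊆ q.H
          · simp only [if_neg h, if_pos h']
            exact fun hR => p.bad X (hX.trans hK) hXi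
              (hc _ _ _ hR (hlt _ h' (shift_infinite hXi)))
          · simp only [if_neg h, if_neg h']
            exact p.bad X (hX.trans hK) hXi }
  have hr : r.Refines lt p := by
    refine ⟨hK, fun X hX hXi => ?_⟩
    by_cases h : X ⊆ q.H
    · right
      simp only [r, m', if_pos h]
      have h1 := lt_roundUp hXi (max (q.m X) (p.m X))
      exact ⟨hlt X h hXi, by omega⟩
    · left
      simp only [r, m', if_neg h, and_self]
  have htr : r.H ∩ Iio (x + 1) = p.H ∩ Iio (x + 1) := by
    rw [← hM]
    refine Subset.antisymm (inter_subset_inter_left _ hK) fun y hy => ⟨Or.inl hy, hy.2⟩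
  have h1 := hp x (hq (hX₀ hx)) r hr htr X₀ (hX₀.trans subset_union_right) hX₀i hM.le
  simp only [r, m', if_pos hX₀] at h1
  have h2 := lt_roundUp hX₀i (max (q.m X₀) (p.m X₀))
  omega

end BadArray

/-! ### Barriers and bad arrays -/

namespace BadArray

variable {T : Type*} {R : T → T → Prop}

/-- The initial segment of `X` which determines `p.f X`. -/
def seg (p : BadArray R) (X : Set ℕ) : Set ℕ := X ∩ Iio (p.m X)

theorem seg_finite (p : BadArray R) (X : Set ℕ) : (p.seg X).Finite :=
  (finite_Iio _).subset inter_subset_right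

theorem congr_of_seg_eq (p : BadArray R) {X Y : Set ℕ} (hX : X ⊆ p.H) (hXi : X.Infinite)
    (hY : Y ⊆ p.H) (hYi : Y.Infinite) (h : p.seg X = p.seg Y) :
    p.f Y = p.f X ∧ p.m Y = p.m X := by
  obtain ⟨x, hx, hxm⟩ := p.mem X hX hXi
  obtain ⟨y, hy, hym⟩ := p.mem Y hY hYi
  have h1 : x ∈ p.seg Y := h ▸ ⟨hx, by rw [hxm]; exact Nat.lt_succ_self x⟩
  have h2 : y ∈ p.seg X := h ▸ ⟨hy, by rw [hym]; exact Nat.lt_succ_self y⟩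
  have h3 : x < p.m Y := h1.2
  have h4 : y < p.m X := h2.2
  have h5 : p.m Y = p.m X := by omega
  refine p.loc X hX hXi Y hY hYi ?_
  unfold seg at h
  rwa [h5] at h

theorem exists_antichain (p : BadArray R) : ∃ K ⊆ p.H, K.Infinite ∧
    ∀ X ⊆ K, X.Infinite → ∀ Y ⊆ K, Y.Infinite → p.seg Y ⊆ p.seg X → p.seg Y = p.seg X := by
  have hloc : LocallyDetermined p.H fun X =>
      ∀ Y ⊆ p.H, Y.Infinite → p.seg Y ⊆ p.seg X → p.seg Y = p.seg X := by
    intro X hX hXi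
    refine ⟨p.m X, fun Y hY hYi h => ?_⟩
    have : p.seg Y = p.seg X := by
      unfold seg
      rw [(p.loc X hX hXi Y hY hYi h).2, h]
    simp only [this]
  obtain ⟨K, hKH, hKi, c, hc⟩ := hloc.exists_homogeneous p.infinite
  refine ⟨K, hKH, hKi, ?_⟩
  by_cases hcT : c
  · intro X hX hXi Y hY hYi h
    exact (cast (hc X hX hXi).symm hcT) Y (hY.trans hKH) hYi h
  · exfalso
    obtain ⟨X, ⟨hX, hXi⟩, hmin⟩ := (measure fun X => (p.seg X).ncard).wf.has_min
      {X | X ⊆ K ∧ X.Infinite} ⟨K, Subset.rfl, hKi⟩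
    have h1 : ¬ ∀ Y ⊆ p.H, Y.Infinite → p.seg Y ⊆ p.seg X → p.seg Y = p.seg X := fun h =>
      hcT (cast (hc X hX hXi) h)
    push Not at h1
    obtain ⟨Y, hY, hYi, hs, hne⟩ := h1
    have hZK : p.seg Y ∪ K \ Iio (p.m Y) ⊆ K :=
      union_subset (hs.trans (inter_subset_left.trans hX)) sdiff_subset
    have hZi : (p.seg Y ∪ K \ Iio (p.m Y)).Infinite :=
      (hKi.sdiff (finite_Iio _)).mono subset_union_right
    have hZ : Y ∩ Iio (p.m Y) = (p.seg Y ∪ K \ Iio (p.m Y)) ∩ Iio (p.m Y) := by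
      ext y
      simp only [seg, mem_inter_iff, mem_union, Set.mem_sdiff]
      tauto
    have h2 : p.seg (p.seg Y ∪ K \ Iio (p.m Y)) = p.seg Y := by
      conv_lhs => rw [seg]
      rw [(p.loc Y hY hYi _ (hZK.trans hKH) hZi hZ).2, ← hZ]
      rfl
    refine hmin _ ⟨hZK, hZi⟩ ?_
    change (p.seg _).ncard < (p.seg X).ncard
    rw [h2]
    exact ncard_lt_ncard (hs.ssubset_of_ne hne) (p.seg_finite X)

theorem isEmpty_of_isBqo (h : IsBqo R) : IsEmpty (BadArray R) := by
  classical
  refine ⟨fun p => ?_⟩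
  obtain ⟨K, hKH, hKi, hanti⟩ := p.exists_antichain
  let B : Set (Finset ℕ) := {s | ∃ X ⊆ K, X.Infinite ∧ (s : Set ℕ) = p.seg X}
  let F : Finset ℕ → T := fun s =>
    if hs : ∃ X ⊆ K, X.Infinite ∧ (s : Set ℕ) = p.seg X then p.f hs.choose else p.f K
  have hF : ∀ (s : Finset ℕ) (X : Set ℕ), X ⊆ K → X.Infinite → (s : Set ℕ) = p.seg X → F s = p.f X := by
    intro s X hX hXi hs
    have hex : ∃ X ⊆ K, X.Infinite ∧ (s : Set ℕ) = p.seg X := ⟨X, hX, hXi, hs⟩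
    have h1 : F s = p.f hex.choose := dif_pos hex
    rw [h1]
    obtain ⟨h2, h3, h4⟩ := hex.choose_spec
    exact (p.congr_of_seg_eq (hX.trans hKH) hXi (h2.trans hKH) h3 (hs.symm.trans h4)).1
  have hmem : ∀ X ⊆ K, X.Infinite → ∃ s ∈ B, (s : Set ℕ) = p.seg X := fun X hX hXi =>
    ⟨(p.seg_finite X).toFinset, ⟨X, hX, hXi, by simp⟩, by simp⟩
  have hB : IsBarrier B := by
    refine ⟨⟨fun hfin => ?_, fun X hXi hX => ?_⟩, ?_⟩
    · obtain ⟨N, hN⟩ := (hfin.biUnion fun s _ => s.finite_toSet).bddAbove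
      have hi : (K \ Iic N).Infinite := hKi.sdiff (finite_Iic N)
      obtain ⟨s, hs, hseg⟩ := hmem _ sdiff_subset hi
      obtain ⟨x, hx, hxm⟩ := p.mem _ (sdiff_subset.trans hKH) hi
      have hxs : x ∈ (s : Set ℕ) := hseg ▸ ⟨hx, by rw [hxm]; exact Nat.lt_succ_self x⟩
      exact hx.2 (hN (mem_biUnion hs hxs))
    · have hXK : X ⊆ K := by
        refine hX.trans (iUnion₂_subset ?_)
        rintro s ⟨Y, hY, -, hs⟩
        rw [hs]
        exact inter_subset_left.trans hY
      obtain ⟨s, hs, hseg⟩ := hmem X hXK hXi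
      refine ⟨s, hs, ?_⟩
      obtain ⟨x, hx, hxm⟩ := p.mem X (hXK.trans hKH) hXi
      ext y
      rw [hseg]
      have hs' : ∀ z, z ∈ s ↔ z ∈ X ∧ z < x + 1 := fun z => by
        rw [← Finset.mem_coe, hseg, seg, hxm]; rfl
      simp only [seg, hxm, mem_inter_iff, mem_Iio, mem_ofPred_eq, hs']
      constructor
      · rintro ⟨hy, hyx⟩
        exact ⟨hy, x, ⟨hx, Nat.lt_succ_self x⟩, by omega⟩
      · rintro ⟨hy, z, ⟨_, hz⟩, hyz⟩
        exact ⟨hy, by omega⟩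
    · rintro s ⟨X, hX, hXi, hs⟩ t ⟨Y, hY, hYi, ht⟩ hne hst
      refine hne (Finset.coe_injective ?_)
      rw [hs, ht]
      refine hanti Y hY hYi X hX hXi ?_
      rw [← hs, ← ht]
      exact_mod_cast hst
  refine h B hB F ?_
  rintro s ⟨X, hX, hXi, hs⟩ t ⟨Y, hY, hYi, ht⟩ ⟨m, k, i, hk, hkm, hi, rfl, rfl⟩ hR
  obtain ⟨x, hx, hxm⟩ := p.mem X (hX.trans hKH) hXi
  obtain ⟨y, hy, hym⟩ := p.mem Y (hY.trans hKH) hYi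
  have hmX : ∀ z, z ∈ X ∧ z < p.m X ↔ ∃ j, (1 ≤ j ∧ j ≤ k) ∧ i j = z := fun z => by
    rw [show (z ∈ X ∧ z < p.m X) ↔ z ∈ p.seg X from Iff.rfl, ← hs]
    simp
  have hmY : ∀ z, z ∈ Y ∧ z < p.m Y ↔ ∃ j, (2 ≤ j ∧ j ≤ m) ∧ i j = z := fun z => by
    rw [show (z ∈ Y ∧ z < p.m Y) ↔ z ∈ p.seg Y from Iff.rfl, ← ht]
    simp
  have hlt : ∀ a b, 1 ≤ a → a < b → b ≤ m → i a < i b := fun a b ha hab hb =>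
    hi ⟨ha, by omega⟩ ⟨by omega, hb⟩ hab
  have hle : ∀ a b, 1 ≤ a → a ≤ b → b ≤ m → i a ≤ i b := fun a b ha hab hb =>
    hi.monotoneOn ⟨ha, by omega⟩ ⟨by omega, hb⟩ hab
  have hi1 : i 1 ∈ X := ((hmX _).2 ⟨1, ⟨le_rfl, hk⟩, rfl⟩).1
  have hik : i k < p.m X := ((hmX _).2 ⟨k, ⟨hk, le_rfl⟩, rfl⟩).2
  have him : i m < p.m Y := ((hmY _).2 ⟨m, ⟨by omega, le_rfl⟩, rfl⟩).2
  obtain ⟨j, hj, hjx⟩ := (hmX x).1 ⟨hx, by omega⟩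
  have hmXk : p.m X = i k + 1 := by
    have := hle j k hj.1 hj.2 hkm.le
    omega
  have hkm' : i k < i m := hlt k m hk hkm le_rfl
  have hYge : ∀ z ∈ Y, i 1 < z := by
    intro z hz
    by_cases hzm : z < p.m Y
    · obtain ⟨j, hj, rfl⟩ := (hmY z).1 ⟨hz, hzm⟩
      exact hlt 1 j le_rfl (by omega) hj.2
    · have := hle 1 k le_rfl hk hkm.le
      omega
  have hZK : insert (i 1) Y ⊆ K := insert_subset (hX hi1) hY
  have hZi : (insert (i 1) Y).Infinite := hYi.mono (subset_insert _ _)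
  have hinf : sInf (insert (i 1) Y) = i 1 := by
    refine le_antisymm (Nat.sInf_le (mem_insert _ _)) ?_
    rcases Nat.sInf_mem (s := insert (i 1) Y) ⟨_, mem_insert _ _⟩ with h1 | h1
    · exact h1.ge
    · exact (hYge _ h1).le
  have hshift : shift (insert (i 1) Y) = Y := by
    unfold shift
    rw [hinf, insert_sdiff_self_of_notMem fun h1 => lt_irrefl _ (hYge _ h1)]
  have hZX : X ∩ Iio (p.m X) = insert (i 1) Y ∩ Iio (p.m X) := by
    ext z
    constructor
    · rintro hz
      refine ⟨?_, hz.2⟩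
      obtain ⟨j, hj, rfl⟩ := (hmX z).1 hz
      by_cases hj1 : j = 1
      · exact Or.inl (by rw [hj1])
      · exact Or.inr ((hmY _).2 ⟨j, ⟨by omega, by omega⟩, rfl⟩).1
    · rintro ⟨rfl | hz, hzX⟩
      · exact ⟨hi1, hzX⟩
      · simp only [mem_Iio] at hzX
        obtain ⟨j, hj, rfl⟩ := (hmY z).1 ⟨hz, by omega⟩
        refine (hmX _).2 ⟨j, ⟨by omega, ?_⟩, rfl⟩
        by_contra hjk
        have := hlt k j hk (by omega) hj.2
        omega
  have h1 := p.bad _ (hZK.trans hKH) hZi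
  rw [hshift, (p.loc X (hX.trans hKH) hXi _ (hZK.trans hKH) hZi hZX).1] at h1
  rw [hF _ X hX hXi hs, hF _ Y hY hYi ht] at hR
  exact h1 hR

end BadArray

/-! ### Well-quasi-orders of recursively decomposed objects -/

namespace BadArray

variable {T : Type*} {R : T → T → Prop}

/-- A bound for the initial segment of `X` which determines `p.f X` and `p.f (shift X)`. -/
noncomputable def pairBound (p : BadArray R) (X : Set ℕ) : ℕ :=
  roundUp X (max (p.m X) (p.m (shift X)))

theorem pairBound_congr (p : BadArray R) {X Y : Set ℕ} (hX : X ⊆ p.H) (hXi : X.Infinite)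
    (hY : Y ⊆ p.H) (hYi : Y.Infinite) (h : X ∩ Iio (p.pairBound X) = Y ∩ Iio (p.pairBound X)) :
    p.f Y = p.f X ∧ p.f (shift Y) = p.f (shift X) ∧ p.pairBound Y = p.pairBound X := by
  have h0 : max (p.m X) (p.m (shift X)) < p.pairBound X := lt_roundUp hXi _
  obtain ⟨x, hx, hxm⟩ := p.mem X hX hXi
  have hinf : sInf X ≤ x := Nat.sInf_le hx
  have h1 := p.loc X hX hXi Y hY hYi (inter_Iio_mono (by omega) h)
  have h2 := shift_inter_Iio_eq hXi.nonempty (by omega) h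
  have h3 := p.loc (shift X) ((shift_subset X).trans hX) (shift_infinite hXi) (shift Y)
    ((shift_subset Y).trans hY) (shift_infinite hYi) (inter_Iio_mono (by omega) h2)
  refine ⟨h1.1, h3.1, ?_⟩
  unfold pairBound at h ⊢
  rw [h1.2, h3.2]
  exact roundUp_congr hXi h

/-- A bad array computed from the consecutive pairs of values of a bad array. -/
noncomputable def ofPair (p : BadArray R) {K : Set ℕ} (hK : K ⊆ p.H) (hKi : K.Infinite)
    {T' : Type*} {R' : T' → T' → Prop} (g : T → T → T')
    (hg : ∀ X ⊆ K, X.Infinite →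
      ¬ R' (g (p.f X) (p.f (shift X))) (g (p.f (shift X)) (p.f (shift (shift X))))) :
    BadArray R' where
  H := K
  infinite := hKi
  f X := g (p.f X) (p.f (shift X))
  m := p.pairBound
  mem _ _ hXi := exists_roundUp_eq hXi _
  loc X hX hXi Y hY hYi h := by
    obtain ⟨h1, h2, h3⟩ := p.pairBound_congr (hX.trans hK) hXi (hY.trans hK) hYi h
    exact ⟨by rw [h1, h2], h3⟩
  bad := hg

end BadArray

/-- Objects labelled by a bqo, which are compared by comparing their labels and dominating, for
every `i`, each of their `i`-th children, form a wqo. -/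
theorem exists_rel_of_decomposition {Q T ι : Type*} [Finite ι] {r : Q → Q → Prop} (hr : IsBqo r)
    {R lt : T → T → Prop} (ht : ∀ a b c, lt a b → lt b c → lt a c) (hw : WellFounded lt)
    (hc : ∀ a b c, R a b → lt b c → R a c) (lab : T → Q) (ch : ι → T → Set T)
    (hch : ∀ i t, ∀ c ∈ ch i t, lt c t)
    (hR : ∀ t t', r (lab t) (lab t') → (∀ i, ∀ c ∈ ch i t, ∃ c' ∈ ch i t', R c c') → R t t')
    (f : ℕ → T) : ∃ i j, i < j ∧ R (f i) (f j) := by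
  by_contra! hbad
  let p₀ : BadArray R :=
    { H := univ
      infinite := infinite_univ
      f := fun X => f (sInf X)
      m := fun X => sInf X + 1
      mem := fun X _ hXi => ⟨_, Nat.sInf_mem hXi.nonempty, rfl⟩
      loc := by
        intro X _ hXi Y _ _ h
        have h1 : sInf X ∈ Y := mem_of_inter_Iio_eq h (Nat.sInf_mem hXi.nonempty)
          (Nat.lt_succ_self _)
        have h2 : sInf Y ≤ sInf X := Nat.sInf_le h1
        have h3 : sInf X ≤ sInf Y := Nat.sInf_le
          (mem_of_inter_Iio_eq h.symm (Nat.sInf_mem ⟨_, h1⟩) (Nat.lt_succ_of_le h2))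
        rw [le_antisymm h2 h3]
        exact ⟨rfl, rfl⟩
      bad := fun X _ hXi => hbad _ _
        (sInf_lt_of_mem_shift (Nat.sInf_mem (shift_infinite hXi).nonempty)) }
  obtain ⟨p, hp⟩ := BadArray.exists_minimal ht hw hc p₀
  have hcol : ∀ t t', ∃ o : Option ι, ¬ R t t' →
      o.elim (¬ r (lab t) (lab t')) fun i => ∃ c ∈ ch i t, ∀ c' ∈ ch i t', ¬ R c c' := by
    intro t t'
    by_cases h : R t t'
    · exact ⟨none, fun h' => absurd h h'⟩
    by_cases h1 : r (lab t) (lab t')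
    · have h2 := mt (hR t t' h1) h
      push Not at h2
      obtain ⟨i, hi⟩ := h2
      exact ⟨some i, fun _ => hi⟩
    · exact ⟨none, fun _ => h1⟩
  choose col hcol using hcol
  have hloc : LocallyDetermined p.H fun X => col (p.f X) (p.f (shift X)) := by
    intro X hX hXi
    refine ⟨p.pairBound X, fun Y hY hYi h => ?_⟩
    obtain ⟨h1, h2, -⟩ := p.pairBound_congr hX hXi hY hYi h
    dsimp only
    rw [h1, h2]
  obtain ⟨K, hK, hKi, o, ho⟩ := hloc.exists_homogeneous p.infinite
  have ho' : ∀ X ⊆ K, X.Infinite → o.elim (¬ r (lab (p.f X)) (lab (p.f (shift X))))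
      fun i => ∃ c ∈ ch i (p.f X), ∀ c' ∈ ch i (p.f (shift X)), ¬ R c c' := by
    intro X hX hXi
    have h1 := hcol _ _ (p.bad X (hX.trans hK) hXi)
    rwa [ho X hX hXi] at h1
  rcases o with _ | i
  · exact (BadArray.isEmpty_of_isBqo hr).false (p.ofPair hK hKi (fun t _ => lab t) ho')
  · have hg : ∀ t t', ∃ c, (∃ c ∈ ch i t, ∀ c' ∈ ch i t', ¬ R c c') →
        c ∈ ch i t ∧ ∀ c' ∈ ch i t', ¬ R c c' := by
      intro t t'
      by_cases h : ∃ c ∈ ch i t, ∀ c' ∈ ch i t', ¬ R c c'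
      · exact ⟨h.choose, fun _ => h.choose_spec⟩
      · exact ⟨t, fun h' => absurd h' h⟩
    choose g hg using hg
    refine hp (p.ofPair hK hKi g fun X hX hXi => ?_) hK fun X hX hXi => ?_
    · have hY := (shift_subset X).trans hX
      exact (hg _ _ (ho' X hX hXi)).2 _ (hg _ _ (ho' _ hY (shift_infinite hXi))).1
    · exact hch i _ _ (hg _ _ (ho' X hX hXi)).1

/-! ### Gluing embeddings -/

theorem exists_strictMonoOn_glue {ι : Type*} [LinearOrder ι] {V V' : ι → Set ℝ}
    (hV : ∀ i j, i < j → ∀ a ∈ V i, ∀ b ∈ V j, a < b)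
    (hV' : ∀ i j, i < j → ∀ a ∈ V' i, ∀ b ∈ V' j, a < b) (h : ι → ℝ → ℝ)
    (hm : ∀ i, ∀ a ∈ V i, h i a ∈ V' i) (hs : ∀ i, ∀ a ∈ V i, ∀ b ∈ V i, a < b → h i a < h i b) :
    ∃ H : ℝ → ℝ, (∀ i, EqOn H (h i) (V i)) ∧
      ∀ a ∈ ⋃ i, V i, ∀ b ∈ ⋃ i, V i, a < b → H a < H b := by
  classical
  let H : ℝ → ℝ := fun y => if hy : ∃ i, y ∈ V i then h hy.choose y else 0
  have hH : ∀ i, EqOn H (h i) (V i) := by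
    intro i y hy
    have hex : ∃ i, y ∈ V i := ⟨i, hy⟩
    have h1 : H y = h hex.choose y := dif_pos hex
    rw [h1]
    rcases lt_trichotomy hex.choose i with h2 | h2 | h2
    · exact absurd (hV _ _ h2 y hex.choose_spec y hy) (lt_irrefl _)
    · rw [h2]
    · exact absurd (hV _ _ h2 y hy y hex.choose_spec) (lt_irrefl _)
  refine ⟨H, hH, fun a ha b hb hab => ?_⟩
  obtain ⟨i, hi⟩ := mem_iUnion.1 ha
  obtain ⟨j, hj⟩ := mem_iUnion.1 hb
  rw [hH i hi, hH j hj]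
  rcases lt_trichotomy i j with h2 | rfl | h2
  · exact hV' i j h2 _ (hm i a hi) _ (hm j b hj)
  · exact hs i a hi b hj hab
  · exact absurd (hV _ _ h2 b hj a hi) hab.not_gt

/-- The sets `V n` form an increasing sequence converging to `x`, consecutive ones being separated
by points. -/
def ConvergesUp (V : ℕ → Set ℝ) (x : ℝ) : Prop :=
  ∃ c : ℕ → ℝ, Monotone c ∧ (∀ n, c n < x) ∧ Tendsto c atTop (𝓝 x) ∧
    (∀ n, V n ⊆ Iio (c n)) ∧ ∀ n, V (n + 1) ⊆ Ioi (c n)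

theorem ConvergesUp.lt {V : ℕ → Set ℝ} {x : ℝ} (hV : ConvergesUp V x) {n : ℕ} {a : ℝ}
    (ha : a ∈ V n) : a < x := by
  obtain ⟨c, -, h2, -, h4, -⟩ := hV
  exact (h4 n ha).trans (h2 n)

theorem ConvergesUp.lt_of_lt {V : ℕ → Set ℝ} {x : ℝ} (hV : ConvergesUp V x) {m n : ℕ}
    (hmn : m < n) {a b : ℝ} (ha : a ∈ V m) (hb : b ∈ V n) : a < b := by
  obtain ⟨c, h1, -, -, h4, h5⟩ := hV
  obtain ⟨n, rfl⟩ := Nat.exists_eq_succ_of_ne_zero (Nat.ne_zero_of_lt hmn)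
  exact ((h4 m ha).trans_le (h1 (Nat.le_of_lt_succ hmn))).trans (h5 n hb)

theorem ConvergesUp.exists_glue {V V' : ℕ → Set ℝ} {x x' : ℝ} (hV : ConvergesUp V x)
    (hV' : ConvergesUp V' x') {k : ℕ → ℕ} (hk : StrictMono k) (h : ℕ → ℝ → ℝ)
    (hm : ∀ i, ∀ a ∈ V i, h i a ∈ V' (k i))
    (hs : ∀ i, ∀ a ∈ V i, ∀ b ∈ V i, a < b → h i a < h i b)
    (hc : ∀ i, ContinuousOn (h i) (V i)) :
    ∃ H : ℝ → ℝ, (∀ i, EqOn H (h i) (V i)) ∧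
      (∀ a ∈ ⋃ i, V i, ∀ b ∈ ⋃ i, V i, a < b → H a < H b) ∧
      ContinuousOn H (⋃ i, V i) ∧ Tendsto H (𝓝[⋃ i, V i] x) (𝓝 x') := by
  obtain ⟨H, hH, hHs⟩ := exists_strictMonoOn_glue (V' := fun i => V' (k i))
    (fun i j hij a ha b hb => hV.lt_of_lt hij ha hb)
    (fun i j hij a ha b hb => hV'.lt_of_lt (hk hij) ha hb) h hm hs
  refine ⟨H, hH, hHs, ?_, ?_⟩
  · intro y hy
    obtain ⟨n, hn⟩ := mem_iUnion.1 hy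
    have hcont : ContinuousWithinAt H (V n) y := ((hc n).congr (hH n)) y hn
    refine hcont.mono_of_mem_nhdsWithin ?_
    obtain ⟨c, h1, -, -, h4, h5⟩ := hV
    have hsucc : ∀ i, n < i → ∀ b ∈ V i, c n < b := by
      intro i hi b hb
      obtain ⟨i, rfl⟩ := Nat.exists_eq_succ_of_ne_zero (Nat.ne_zero_of_lt hi)
      exact (h1 (Nat.le_of_lt_succ hi)).trans_lt (h5 i hb)
    have hlow : ∃ d < y, ∀ i < n, V i ⊆ Iio d := by
      rcases n with _ | n
      · exact ⟨y - 1, by linarith, fun i hi => absurd hi (Nat.not_lt_zero i)⟩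
      · exact ⟨c n, h5 n hn, fun i hi b hb =>
          lt_of_lt_of_le (mem_Iio.1 (h4 i hb)) (h1 (Nat.le_of_lt_succ hi))⟩
    obtain ⟨d, hd, hdV⟩ := hlow
    refine mem_nhdsWithin.2 ⟨Ioo d (c n), isOpen_Ioo, ⟨hd, h4 n hn⟩, ?_⟩
    rintro z ⟨⟨hz1, hz2⟩, hz3⟩
    obtain ⟨i, hi⟩ := mem_iUnion.1 hz3
    rcases lt_trichotomy i n with h6 | rfl | h6
    · exact absurd (hdV i h6 hi) hz1.not_gt
    · exact hi
    · exact absurd (hsucc i h6 z hi) hz2.not_gt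
  · rw [tendsto_order]
    constructor
    · intro b hb
      obtain ⟨c, h1, h2, h3, h4, h5⟩ := hV
      obtain ⟨c', h1', h2', h3', h4', h5'⟩ := hV'
      obtain ⟨N, hN⟩ := ((tendsto_order.1 h3').1 b hb).exists
      refine mem_nhdsWithin.2 ⟨Ioi (c N), isOpen_Ioi, h2 N, ?_⟩
      rintro z ⟨hz1, hz2⟩
      obtain ⟨i, hi⟩ := mem_iUnion.1 hz2
      have hNi : N < i := by
        by_contra hNi
        exact lt_irrefl _ ((hz1.trans (h4 i hi)).trans_le (h1 (not_lt.1 hNi)))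
      obtain ⟨l, hl⟩ := Nat.exists_eq_succ_of_ne_zero (n := k i)
        (Nat.ne_zero_of_lt (hNi.trans_le (hk.id_le i)))
      have h6 : H z ∈ V' (l + 1) := by
        rw [hH i hi, ← Nat.succ_eq_add_one, ← hl]
        exact hm i z hi
      have h7 := hk.id_le i
      simp only [id] at h7
      exact (hN.trans_le (h1' (by omega))).trans (h5' l h6)
    · intro b hb
      refine mem_nhdsWithin.2 ⟨univ, isOpen_univ, mem_univ x, ?_⟩
      rintro z ⟨-, hz2⟩
      obtain ⟨i, hi⟩ := mem_iUnion.1 hz2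
      have h6 := hm i z hi
      rw [← hH i hi] at h6
      exact (hV'.lt h6).trans hb

/-- The mirror image of a sequence of sets. -/
def mirror (V : ℕ → Set ℝ) : ℕ → Set ℝ := fun n => Neg.neg ⁻¹' V n

/-- The sets `V n` form a decreasing sequence converging to `x`, consecutive ones being separated
by points. -/
def ConvergesDown (V : ℕ → Set ℝ) (x : ℝ) : Prop := ConvergesUp (mirror V) (-x)

theorem neg_mem_mirror {V : ℕ → Set ℝ} {n : ℕ} {a : ℝ} : -a ∈ mirror V n ↔ a ∈ V n := by
  simp [mirror]

theorem ConvergesDown.lt {V : ℕ → Set ℝ} {x : ℝ} (hV : ConvergesDown V x) {n : ℕ} {a : ℝ}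
    (ha : a ∈ V n) : x < a := by
  have := ConvergesUp.lt hV (neg_mem_mirror.2 ha)
  linarith

theorem ConvergesDown.exists_glue {V V' : ℕ → Set ℝ} {x x' : ℝ} (hV : ConvergesDown V x)
    (hV' : ConvergesDown V' x') {k : ℕ → ℕ} (hk : StrictMono k) (h : ℕ → ℝ → ℝ)
    (hm : ∀ i, ∀ a ∈ V i, h i a ∈ V' (k i))
    (hs : ∀ i, ∀ a ∈ V i, ∀ b ∈ V i, a < b → h i a < h i b)
    (hc : ∀ i, ContinuousOn (h i) (V i)) :
    ∃ H : ℝ → ℝ, (∀ i, EqOn H (h i) (V i)) ∧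
      (∀ a ∈ ⋃ i, V i, ∀ b ∈ ⋃ i, V i, a < b → H a < H b) ∧
      ContinuousOn H (⋃ i, V i) ∧ Tendsto H (𝓝[⋃ i, V i] x) (𝓝 x') := by
  obtain ⟨H, h1, h2, h3, h4⟩ := ConvergesUp.exists_glue hV hV' hk (fun i y => -h i (-y))
    (fun i a ha => neg_mem_mirror.2 (hm i _ ha))
    (fun i a ha b hb hab => neg_lt_neg (hs i _ hb _ ha (neg_lt_neg hab)))
    (fun i => ((hc i).comp continuousOn_neg fun a ha => ha).neg)
  have hU : ∀ a ∈ ⋃ i, V i, -a ∈ ⋃ i, mirror V i := by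
    intro a ha
    obtain ⟨i, hi⟩ := mem_iUnion.1 ha
    exact mem_iUnion.2 ⟨i, neg_mem_mirror.2 hi⟩
  refine ⟨fun y => -H (-y), ?_, ?_, ?_, ?_⟩
  · intro i a ha
    have := h1 i (neg_mem_mirror.2 ha)
    simp only [this, neg_neg]
  · intro a ha b hb hab
    exact neg_lt_neg (h2 _ (hU b hb) _ (hU a ha) (neg_lt_neg hab))
  · exact (h3.comp continuousOn_neg hU).neg
  · have h5 : Tendsto (fun y : ℝ => -y) (𝓝[⋃ i, V i] x) (𝓝[⋃ i, mirror V i] (-x)) :=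
      tendsto_nhdsWithin_of_tendsto_nhds_of_eventually_within _
        (continuous_neg.tendsto x |>.mono_left nhdsWithin_le_nhds)
        (eventually_nhdsWithin_of_forall hU)
    have := (h4.comp h5).neg
    rwa [neg_neg] at this

namespace QCclo

variable {Q : Type}

theorem Emb.refl [Preorder Q] (A : QCclo Q) : A.Emb A :=
  ⟨id, ⟨fun _ h => h, fun _ _ _ _ h => h, continuousOn_id⟩, fun _ _ => le_rfl⟩

theorem Emb.trans [Preorder Q] {A B C : QCclo Q} (h : A.Emb B) (h' : B.Emb C) : A.Emb C := by
  obtain ⟨f, ⟨f1, f2, f3⟩, f4⟩ := h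
  obtain ⟨g, ⟨g1, g2, g3⟩, g4⟩ := h'
  exact ⟨g ∘ f, ⟨fun x hx => g1 _ (f1 x hx),
    fun x hx y hy hxy => g2 _ (f1 x hx) _ (f1 y hy) (f2 x hx y hy hxy), g3.comp f3 f1⟩,
    fun a ha => (f4 a ha).trans (g4 _ (f1 a ha))⟩

theorem Emb.of_subset [Preorder Q] {A B : QCclo Q} (h : A.dom ⊆ B.dom)
    (hv : ∀ y ∈ A.dom, B.val y = A.val y) : A.Emb B :=
  ⟨id, ⟨h, fun _ _ _ _ h => h, continuousOn_id⟩, fun a ha => (hv a ha).ge⟩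

theorem Emb.of_empty [Preorder Q] {A : QCclo Q} (h : A.dom = ∅) (B : QCclo Q) : A.Emb B := by
  refine ⟨id, ⟨?_, fun _ _ _ _ h => h, continuousOn_id⟩, ?_⟩ <;> simp [h]

/-- `A` is the concatenation of the pieces `P i`. -/
structure IsConcat {ι : Type*} [LT ι] (A : QCclo Q) (P : ι → QCclo Q) : Prop where
  dom_eq : A.dom = ⋃ i, (P i).dom
  val_eq : ∀ i, ∀ y ∈ (P i).dom, A.val y = (P i).val y
  lt : ∀ i j, i < j → ∀ a ∈ (P i).dom, ∀ b ∈ (P j).dom, a < b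

theorem IsConcat.emb [Preorder Q] {ι : Type*} [LinearOrder ι] [Finite ι] {A B : QCclo Q}
    {P P' : ι → QCclo Q} (hA : A.IsConcat P) (hB : B.IsConcat P')
    (h : ∀ i, (P i).Emb (P' i)) : A.Emb B := by
  choose f hf1 hf2 using h
  obtain ⟨H, h1, h2⟩ := exists_strictMonoOn_glue hA.lt hB.lt f (fun i => (hf1 i).1)
    fun i => (hf1 i).2.1
  refine ⟨H, ⟨?_, ?_, ?_⟩, ?_⟩
  · rw [hA.dom_eq, hB.dom_eq]
    intro y hy
    obtain ⟨i, hi⟩ := mem_iUnion.1 hy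
    rw [h1 i hi]
    exact mem_iUnion.2 ⟨i, (hf1 i).1 y hi⟩
  · rwa [hA.dom_eq]
  · rw [hA.dom_eq]
    exact (locallyFinite_of_finite _).continuousOn_iUnion (fun i => (P i).dom_closed)
      fun i => (hf1 i).2.2.congr (h1 i)
  · rw [hA.dom_eq]
    intro y hy
    obtain ⟨i, hi⟩ := mem_iUnion.1 hy
    rw [h1 i hi, hA.val_eq i y hi, hB.val_eq i _ ((hf1 i).1 y hi)]
    exact hf2 i y hi

/-- `L` is the sum of the `Ls n`, of a point `x` labelled `p`, and of the `Rs n` in reverse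
order; pieces may be empty. -/
structure IsCenteredSum (L : QCclo Q) (Ls Rs : ℕ → QCclo Q) (p : Q) (x : ℝ) : Prop where
  left : ConvergesUp (fun n => (Ls n).dom) x
  right : ConvergesDown (fun n => (Rs n).dom) x
  dom_eq : L.dom = (⋃ n, (Ls n).dom) ∪ {x} ∪ ⋃ n, (Rs n).dom
  val_left : ∀ n, ∀ y ∈ (Ls n).dom, L.val y = (Ls n).val y
  val_right : ∀ n, ∀ y ∈ (Rs n).dom, L.val y = (Rs n).val y
  val_center : L.val x = p

/-- A sequence of cclos embeds termwise into a subsequence of another one. -/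
def SeqEmb [Preorder Q] (Ls Ls' : ℕ → QCclo Q) : Prop :=
  ∃ k : ℕ → ℕ, StrictMono k ∧ ∀ n, (Ls n).Emb (Ls' (k n))

theorem IsCenteredSum.emb [Preorder Q] {L L' : QCclo Q} {Ls Rs Ls' Rs' : ℕ → QCclo Q} {p p' : Q}
    {x x' : ℝ} (hL : L.IsCenteredSum Ls Rs p x) (hL' : L'.IsCenteredSum Ls' Rs' p' x')
    (hp : p ≤ p') (hl : SeqEmb Ls Ls') (hr : SeqEmb Rs Rs') : L.Emb L' := by
  classical
  obtain ⟨k, hk, hl⟩ := hl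
  obtain ⟨k', hk', hr⟩ := hr
  choose f hf1 hf2 using hl
  choose g hg1 hg2 using hr
  obtain ⟨F, F1, F2, F3, F4⟩ := hL.left.exists_glue hL'.left hk f (fun i => (hf1 i).1)
    (fun i => (hf1 i).2.1) (fun i => (hf1 i).2.2)
  obtain ⟨G, G1, G2, G3, G4⟩ := hL.right.exists_glue hL'.right hk' g (fun i => (hg1 i).1)
    (fun i => (hg1 i).2.1) (fun i => (hg1 i).2.2)
  set U := ⋃ n, (Ls n).dom with hU
  set W := ⋃ n, (Rs n).dom with hW
  have hUx : ∀ a ∈ U, a < x := fun a ha => by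
    obtain ⟨n, hn⟩ := mem_iUnion.1 ha
    exact hL.left.lt hn
  have hWx : ∀ a ∈ W, x < a := fun a ha => by
    obtain ⟨n, hn⟩ := mem_iUnion.1 ha
    exact hL.right.lt hn
  have hFx : ∀ a ∈ U, F a < x' := fun a ha => by
    obtain ⟨n, hn⟩ := mem_iUnion.1 ha
    rw [F1 n hn]
    exact hL'.left.lt ((hf1 n).1 a hn)
  have hGx : ∀ a ∈ W, x' < G a := fun a ha => by
    obtain ⟨n, hn⟩ := mem_iUnion.1 ha
    rw [G1 n hn]
    exact hL'.right.lt ((hg1 n).1 a hn)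
  let H : ℝ → ℝ := fun y => if y < x then F y else if x < y then G y else x'
  have HU : ∀ a ∈ U, H a = F a := fun a ha => if_pos (hUx a ha)
  have HW : ∀ a ∈ W, H a = G a := fun a ha => by
    simp only [H, if_neg (hWx a ha).not_gt, if_pos (hWx a ha)]
  have Hx : H x = x' := by simp [H]
  refine ⟨H, ⟨?_, ?_, ?_⟩, ?_⟩
  · rw [hL.dom_eq, hL'.dom_eq]
    rintro a ((ha | rfl) | ha)
    · rw [HU a ha]
      obtain ⟨n, hn⟩ := mem_iUnion.1 ha
      rw [F1 n hn]
      exact Or.inl (Or.inl (mem_iUnion.2 ⟨_, (hf1 n).1 a hn⟩))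
    · rw [Hx]
      exact Or.inl (Or.inr rfl)
    · rw [HW a ha]
      obtain ⟨n, hn⟩ := mem_iUnion.1 ha
      rw [G1 n hn]
      exact Or.inr (mem_iUnion.2 ⟨_, (hg1 n).1 a hn⟩)
  · rw [hL.dom_eq]
    rintro a ((ha | rfl) | ha) b ((hb | rfl) | hb) hab
    · rw [HU a ha, HU b hb]
      exact F2 a ha b hb hab
    · rw [HU a ha, Hx]
      exact hFx a ha
    · rw [HU a ha, HW b hb]
      exact (hFx a ha).trans (hGx b hb)
    · exact absurd hab (hUx b hb).not_gt
    · exact absurd hab (lt_irrefl _)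
    · rw [Hx, HW b hb]
      exact hGx b hb
    · exact absurd hab ((hUx b hb).trans (hWx a ha)).not_gt
    · exact absurd hab (hWx a ha).not_gt
    · rw [HW a ha, HW b hb]
      exact G2 a ha b hb hab
  · rw [hL.dom_eq]
    rintro a ((ha | rfl) | ha)
    · have h1 : ContinuousWithinAt H U a := (F3.congr HU) a ha
      refine h1.mono_of_mem_nhdsWithin
        (mem_nhdsWithin.2 ⟨Iio x, isOpen_Iio, hUx a ha, ?_⟩)
      rintro b ⟨hb, (h2 | rfl) | h2⟩
      exacts [h2, absurd hb self_notMem_Iio, absurd hb (hWx b h2).not_gt]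
    · refine (ContinuousWithinAt.union ?_ continuousWithinAt_singleton).union ?_
      · unfold ContinuousWithinAt
        rw [Hx]
        exact F4.congr' (eventually_nhdsWithin_of_forall fun b hb => (HU b hb).symm)
      · unfold ContinuousWithinAt
        rw [Hx]
        exact G4.congr' (eventually_nhdsWithin_of_forall fun b hb => (HW b hb).symm)
    · have h1 : ContinuousWithinAt H W a := (G3.congr HW) a ha
      refine h1.mono_of_mem_nhdsWithin
        (mem_nhdsWithin.2 ⟨Ioi x, isOpen_Ioi, hWx a ha, ?_⟩)
      rintro b ⟨hb, (h2 | rfl) | h2⟩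
      exacts [absurd hb (hUx b h2).not_gt, absurd hb self_notMem_Ioi, h2]
  · rw [hL.dom_eq]
    rintro a ((ha | rfl) | ha)
    · rw [HU a ha]
      obtain ⟨n, hn⟩ := mem_iUnion.1 ha
      rw [F1 n hn, hL.val_left n a hn, hL'.val_left _ _ ((hf1 n).1 a hn)]
      exact hf2 n a hn
    · rw [Hx, hL.val_center, hL'.val_center]
      exact hp
    · rw [HW a ha]
      obtain ⟨n, hn⟩ := mem_iUnion.1 ha
      rw [G1 n hn, hL.val_right n a hn, hL'.val_right _ _ ((hg1 n).1 a hn)]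
      exact hg2 n a hn

end QCclo

/-! ### Recursively indecomposable cclos -/

theorem exists_forall_frequently {P : Type*} (r : P → P → Prop) [IsTrans P r] (f : ℕ → P)
    (h : ∀ g : ℕ → ℕ, StrictMono g → ∃ i j, i < j ∧ r (f (g i)) (f (g j))) :
    ∃ N, ∀ n, N ≤ n → ∃ᶠ k in atTop, r (f n) (f k) := by
  by_contra! hcon
  have hE : {n | ¬ ∃ᶠ k in atTop, r (f n) (f k)}.Infinite := by
    rw [Set.infinite_iff_exists_gt]
    intro N
    obtain ⟨n, hn, hn'⟩ := hcon (N + 1)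
    exact ⟨n, by simpa using hn', hn⟩
  have he : StrictMono (Nat.nth (· ∈ {n | ¬ ∃ᶠ k in atTop, r (f n) (f k)})) :=
    Nat.nth_strictMono hE
  set e := Nat.nth (· ∈ {n | ¬ ∃ᶠ k in atTop, r (f n) (f k)}) with hedef
  obtain ⟨g, hg | hg⟩ := exists_increasing_or_nonincreasing_subseq r (fun n => f (e n))
  · refine Nat.nth_mem_of_infinite hE (g 0) ?_
    refine Filter.frequently_atTop.2 fun N => ⟨e (g (N + 1)), ?_, hg 0 (N + 1) N.succ_pos⟩
    have := (he.comp g.strictMono).id_le (N + 1)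
    simp only [id, Function.comp_apply] at this
    omega
  · obtain ⟨i, j, hij, hr⟩ := h _ (he.comp g.strictMono)
    exact hg i j hij hr

namespace QCclo

variable {Q : Type} [Preorder Q]

instance : IsTrans (QCclo Q) Emb := ⟨fun _ _ _ => Emb.trans⟩

/-- A recursive decomposition of a cclo into centered sums of sequences each of whose terms embeds
into infinitely many others. -/
inductive Decomp : QCclo Q → Type
  | mk {A : QCclo Q} (Ls Rs : ℕ → QCclo Q) (p : Q) (x : ℝ) (hA : A.IsCenteredSum Ls Rs p x)
      (hl : ∀ n, ∃ᶠ k in atTop, (Ls n).Emb (Ls k)) (hr : ∀ n, ∃ᶠ k in atTop, (Rs n).Emb (Rs k))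
      (dl : ∀ n, (Ls n).dom.Nonempty → Decomp (Ls n))
      (dr : ∀ n, (Rs n).dom.Nonempty → Decomp (Rs n)) : Decomp A

namespace Decomp

/-- The label of the center. -/
def label : (Σ A : QCclo Q, Decomp A) → Q
  | ⟨_, mk _ _ p _ _ _ _ _ _⟩ => p

/-- The nonempty pieces to the left (`false`) and to the right (`true`) of the center. -/
def pieces : Bool → (Σ A : QCclo Q, Decomp A) → Set (Σ A : QCclo Q, Decomp A)
  | false, ⟨_, mk Ls _ _ _ _ _ _ dl _⟩ => {t | ∃ n, ∃ h : (Ls n).dom.Nonempty, t = ⟨Ls n, dl n h⟩}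
  | true, ⟨_, mk _ Rs _ _ _ _ _ _ dr⟩ => {t | ∃ n, ∃ h : (Rs n).dom.Nonempty, t = ⟨Rs n, dr n h⟩}

theorem wellFounded_mem_pieces :
    WellFounded fun c t : Σ A : QCclo Q, Decomp A => ∃ i, c ∈ pieces i t := by
  refine ⟨fun ⟨A, d⟩ => ?_⟩
  induction d with
  | mk Ls Rs p x hA hl hr dl dr ihl ihr =>
    refine ⟨_, ?_⟩
    rintro c ⟨_ | _, n, h, rfl⟩
    exacts [ihl n h, ihr n h]

theorem emb_of_mem_pieces {c t : Σ A : QCclo Q, Decomp A} (h : ∃ i, c ∈ pieces i t) :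
    c.1.Emb t.1 := by
  obtain ⟨A, ⟨Ls, Rs, p, x, hA, hl, hr, dl, dr⟩⟩ := t
  obtain ⟨_ | _, n, h, rfl⟩ := h
  · refine Emb.of_subset ?_ (hA.val_left n)
    rw [hA.dom_eq]
    exact fun y hy => Or.inl (Or.inl (mem_iUnion.2 ⟨n, hy⟩))
  · refine Emb.of_subset ?_ (hA.val_right n)
    rw [hA.dom_eq]
    exact fun y hy => Or.inr (mem_iUnion.2 ⟨n, hy⟩)

theorem exists_emb (hbqo : IsBqo fun p q : Q => p ≤ q) (f : ℕ → QCclo Q)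
    (hf : ∀ n, Nonempty (Decomp (f n))) : ∃ i j, i < j ∧ (f i).Emb (f j) := by
  have key : ∀ Ls Ls' : ℕ → QCclo Q, (∀ n, ∃ᶠ k in atTop, (Ls' n).Emb (Ls' k)) →
      (∀ n, (Ls n).dom.Nonempty → ∃ n', (Ls n).Emb (Ls' n')) → SeqEmb Ls Ls' := by
    intro Ls Ls' h1 h2
    refine extraction_forall_of_frequently (P := fun n k => (Ls n).Emb (Ls' k)) fun n => ?_
    rcases (Ls n).dom.eq_empty_or_nonempty with h | h
    · exact Frequently.of_forall fun k => Emb.of_empty h _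
    · obtain ⟨n', hn'⟩ := h2 n h
      exact (h1 n').mono fun k hk => hn'.trans hk
  refine exists_rel_of_decomposition (T := Σ A : QCclo Q, Decomp A) hbqo
    (R := fun t t' => t.1.Emb t'.1)
    (lt := Relation.TransGen fun c t : Σ A : QCclo Q, Decomp A => ∃ i, c ∈ pieces i t)
    (fun _ _ _ h h' => h.trans h') wellFounded_mem_pieces.transGen ?_ label pieces
    (fun i t c hc => Relation.TransGen.single ⟨i, hc⟩) ?_ (fun n => ⟨f n, (hf n).some⟩)
  · intro a b c hab hbc
    induction hbc with
    | single h => exact hab.trans (emb_of_mem_pieces h)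
    | tail _ h ih => exact ih.trans (emb_of_mem_pieces h)
  · rintro ⟨A, ⟨Ls, Rs, p, x, hA, hl, hr, dl, dr⟩⟩ ⟨A', ⟨Ls', Rs', p', x', hA', hl', hr', dl', dr'⟩⟩
      hp hch
    refine hA.emb hA' hp (key _ _ hl' fun n h => ?_) (key _ _ hr' fun n h => ?_)
    · obtain ⟨_, ⟨n', h', rfl⟩, h''⟩ := hch false _ ⟨n, h, rfl⟩
      exact ⟨n', h''⟩
    · obtain ⟨_, ⟨n', h', rfl⟩, h''⟩ := hch true _ ⟨n, h, rfl⟩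
      exact ⟨n', h''⟩

end Decomp

end QCclo

/-! ### Decomposition of bounded cclos into finitely many indecomposable pieces -/

theorem exists_finite_chain {α : Type*} {r : α → α → Prop} {a b : α}
    (h : Relation.TransGen r a b) :
    ∃ (m : ℕ) (s : ℕ → α), 0 < m ∧ s 0 = a ∧ s m = b ∧ ∀ i < m, r (s i) (s (i + 1)) := by
  induction h using Relation.TransGen.head_induction_on with
  | @single c h =>
    refine ⟨1, fun i => Nat.casesOn i c fun _ => b, Nat.one_pos, rfl, rfl, fun i hi => ?_⟩
    obtain rfl : i = 0 := by omega
    exact h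
  | @head c _ h _ ih =>
    obtain ⟨m, s, hm, h0, hsm, hs⟩ := ih
    refine ⟨m + 1, fun i => Nat.casesOn i c s, Nat.succ_pos m, rfl, hsm, fun i hi => ?_⟩
    rcases i with _ | i
    · change r c (s 0)
      rw [h0]
      exact h
    · exact hs i (by omega)

theorem exists_sequence_of_transGen {α : Type*} {r : α → α → Prop} (u : ℕ → α)
    (h : ∀ n, Relation.TransGen r (u n) (u (n + 1))) :
    ∃ w : ℕ → α, w 0 = u 0 ∧ (∀ n, r (w n) (w (n + 1))) ∧ ∀ n, ∃ k ≥ n, w k = u n := by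
  choose m s hm h0 hsm hs using fun n => exists_finite_chain (h n)
  let nx : ℕ × ℕ → ℕ × ℕ := fun p => if p.2 + 1 < m p.1 then (p.1, p.2 + 1) else (p.1 + 1, 0)
  let st : ℕ → ℕ × ℕ := fun i => nx^[i] (0, 0)
  have hst : ∀ i, st (i + 1) = nx (st i) := fun i => Function.iterate_succ_apply' _ _ _
  have hinv : ∀ i, (st i).2 < m (st i).1 := by
    intro i
    induction i with
    | zero => exact hm 0
    | succ i ih =>
      rw [hst]
      by_cases hi : (st i).2 + 1 < m (st i).1
      · simp only [nx, if_pos hi]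
        exact hi
      · simp only [nx, if_neg hi]
        exact hm _
  refine ⟨fun i => s (st i).1 (st i).2, h0 0, fun i => ?_, fun n => ?_⟩
  · have h1 := hs (st i).1 (st i).2 (hinv i)
    have h2 := hinv i
    simp only [hst]
    by_cases hi : (st i).2 + 1 < m (st i).1
    · simp only [nx, if_pos hi]
      exact h1
    · simp only [nx, if_neg hi]
      have h3 : (st i).2 + 1 = m (st i).1 := by omega
      rw [h0, ← hsm, ← h3]
      exact h1
  · suffices ∃ k ≥ n, st k = (n, 0) by
      obtain ⟨k, hnk, hk⟩ := this
      exact ⟨k, hnk, by simp only [hk, h0]⟩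
    induction n with
    | zero => exact ⟨0, le_rfl, rfl⟩
    | succ n ih =>
      obtain ⟨k, hnk, hk⟩ := ih
      have hj : ∀ j < m n, st (k + j) = (n, j) := by
        intro j
        induction j with
        | zero => exact fun _ => hk
        | succ j ihj =>
          intro hj
          rw [← add_assoc, hst, ihj (by omega)]
          simp only [nx, if_pos hj]
      obtain ⟨l, hl⟩ := Nat.exists_eq_succ_of_ne_zero (hm n).ne'
      refine ⟨k + l + 1, by omega, ?_⟩
      rw [hst, hj l (by omega)]
      simp only [nx, hl, Nat.succ_eq_add_one, lt_irrefl, if_false]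

theorem Monotone.tendsto_of_cofinal {u w : ℕ → ℝ} {x : ℝ} (hw : Monotone w) (hu : ∀ n, u n < x)
    (ht : Tendsto u atTop (𝓝 x)) (h : ∀ n, ∃ k ≥ n, w k = u n) :
    (∀ n, w n < x) ∧ Tendsto w atTop (𝓝 x) := by
  have hx : ∀ n, w n < x := fun n => by
    obtain ⟨k, hk, hku⟩ := h n
    exact (hw hk).trans_lt (hku ▸ hu n)
  refine ⟨hx, tendsto_order.2 ⟨fun b hb => ?_, fun b hb => Eventually.of_forall fun n =>
    (hx n).trans hb⟩⟩
  obtain ⟨n, hn⟩ := ((tendsto_order.1 ht).1 b hb).exists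
  obtain ⟨k, -, hku⟩ := h n
  filter_upwards [eventually_ge_atTop k] with i hi
  exact hn.trans_le (hku ▸ hw hi)

theorem Antitone.tendsto_of_cofinal {u w : ℕ → ℝ} {x : ℝ} (hw : Antitone w) (hu : ∀ n, x < u n)
    (ht : Tendsto u atTop (𝓝 x)) (h : ∀ n, ∃ k ≥ n, w k = u n) :
    (∀ n, x < w n) ∧ Tendsto w atTop (𝓝 x) := by
  obtain ⟨h1, h2⟩ := Monotone.tendsto_of_cofinal (w := fun n => -w n) (u := fun n => -u n)
    (fun i j hij => neg_le_neg (hw hij)) (fun n => neg_lt_neg (hu n)) ht.neg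
    fun n => (h n).imp fun k hk => ⟨hk.1, congrArg Neg.neg hk.2⟩
  exact ⟨fun n => neg_lt_neg_iff.1 (h1 n), by simpa using h2.neg⟩

theorem convergesUp_inter_Icc {V : Set ℝ} {w : ℕ → ℝ} {x : ℝ} (hw : Monotone w)
    (hV : ∀ n, w n ∉ V) (hx : ∀ n, w n < x) (ht : Tendsto w atTop (𝓝 x)) :
    ConvergesUp (fun n => V ∩ Icc (w n) (w (n + 1))) x ∧
      ⋃ n, V ∩ Icc (w n) (w (n + 1)) = V ∩ Ico (w 0) x := by
  refine ⟨⟨fun n => w (n + 1), fun m n h => hw (Nat.succ_le_succ h), fun n => hx _,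
    (tendsto_add_atTop_iff_nat 1).2 ht, ?_, ?_⟩, Subset.antisymm ?_ ?_⟩
  · rintro n y ⟨hy, -, h⟩
    exact lt_of_le_of_ne h fun h' => hV _ (h' ▸ hy)
  · rintro n y ⟨hy, h, -⟩
    exact lt_of_le_of_ne h fun h' => hV _ (h' ▸ hy)
  · rintro y hy
    obtain ⟨n, h1, h2, h3⟩ := mem_iUnion.1 hy
    exact ⟨h1, (hw (Nat.zero_le n)).trans h2, h3.trans_lt (hx _)⟩
  · rintro y ⟨hy, h1, h2⟩
    classical
    have hex : ∃ n, y < w n := ((tendsto_order.1 ht).1 y h2).exists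
    obtain ⟨n, hn⟩ : ∃ n, Nat.find hex = n + 1 := by
      refine Nat.exists_eq_succ_of_ne_zero fun h0 => ?_
      have := Nat.find_spec hex
      rw [h0] at this
      exact this.not_ge h1
    have h3 : y < w (n + 1) := hn ▸ Nat.find_spec hex
    have h4 : w n ≤ y := not_lt.1 (Nat.find_min hex (by omega))
    exact mem_iUnion.2 ⟨n, hy, h4, h3.le⟩

theorem convergesDown_inter_Icc {V : Set ℝ} {w : ℕ → ℝ} {x : ℝ} (hw : Antitone w)
    (hV : ∀ n, w n ∉ V) (hx : ∀ n, x < w n) (ht : Tendsto w atTop (𝓝 x)) :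
    ConvergesDown (fun n => V ∩ Icc (w (n + 1)) (w n)) x ∧
      ⋃ n, V ∩ Icc (w (n + 1)) (w n) = V ∩ Ioc x (w 0) := by
  obtain ⟨h1, h2⟩ := convergesUp_inter_Icc (V := Neg.neg ⁻¹' V) (w := fun n => -w n) (x := -x)
    (fun m n h => neg_le_neg (hw h)) (fun n => by simpa using hV n)
    (fun n => neg_lt_neg (hx n)) ht.neg
  have h3 : ∀ n, Neg.neg ⁻¹' V ∩ Icc (-w n) (-w (n + 1)) =
      Neg.neg ⁻¹' (V ∩ Icc (w (n + 1)) (w n)) := fun n => by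
    ext y
    simp only [mem_inter_iff, mem_preimage, mem_Icc, neg_le, le_neg]
    tauto
  simp only [h3] at h1 h2
  refine ⟨h1, ?_⟩
  ext y
  have h4 := Set.ext_iff.1 h2 (-y)
  simpa [and_comm] using h4

theorem exists_not_accPt {F : Set ℝ} (hF : IsClosed F) (hc : F.Countable) (hne : F.Nonempty) :
    ∃ x ∈ F, ∃ U ∈ 𝓝 x, ∀ y ∈ U, y ∈ F → y = x := by
  by_contra! h
  have hP : Perfect F := ⟨hF, fun x hx => accPt_iff_nhds.2 fun U hU => by
    obtain ⟨y, h1, h2, h3⟩ := h x hx U hU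
    exact ⟨y, ⟨h1, h2⟩, h3⟩⟩
  obtain ⟨f, h1, -, h2⟩ := hP.exists_nat_bool_injection hne
  have h3 : (range f).Countable := hc.mono h1
  have h4 : Countable (ℕ → Bool) := by
    rw [← Set.countable_univ_iff]
    exact Set.countable_of_injective_of_countable_image h2.injOn (by rwa [image_univ])
  obtain ⟨e, he⟩ := exists_surjective_nat (ℕ → Bool)
  obtain ⟨n, hn⟩ := he fun n => !e n n
  simpa using congrFun hn n

namespace QCclo

variable {Q : Type}

/-- The restriction of a cclo to a closed set. -/
def restr (A : QCclo Q) (s : Set ℝ) (hs : IsClosed s) : QCclo Q where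
  dom := A.dom ∩ s
  dom_countable := A.dom_countable.mono inter_subset_left
  dom_closed := A.dom_closed.inter hs
  val := A.val

/-- The part of `A` between `u` and `v`. -/
def between (A : QCclo Q) (u v : ℝ) : QCclo Q := A.restr (Icc u v) isClosed_Icc

theorem isConcat_between (A : QCclo Q) {u c v : ℝ} (huc : u ≤ c) (hcv : c ≤ v) (hc : c ∉ A.dom) :
    (A.between u v).IsConcat fun i => cond i (A.between c v) (A.between u c) := by
  refine ⟨?_, ?_, ?_⟩
  · change A.dom ∩ Icc u v = _
    rw [← Icc_union_Icc_eq_Icc huc hcv, inter_union_distrib_left, union_comm, union_eq_iUnion]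
    congr 1
    ext1 i
    cases i <;> rfl
  · rintro (_ | _) y _ <;> rfl
  · rintro (_ | _) (_ | _) hij a ha b hb
    · exact absurd hij (lt_irrefl _)
    · exact lt_of_lt_of_le (lt_of_le_of_ne ha.2.2 fun h => hc (h ▸ ha.1)) hb.2.1
    · exact absurd hij (by decide)
    · exact absurd hij (lt_irrefl _)

variable [Preorder Q]

/-- The part of `A` between `u` and `v` is empty or recursively indecomposable. -/
def Step (A : QCclo Q) (u v : ℝ) : Prop :=
  u ≤ v ∧ u ∉ A.dom ∧ v ∉ A.dom ∧
    ((A.between u v).dom = ∅ ∨ Nonempty (Decomp (A.between u v)))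

theorem Step.le_of_transGen {A : QCclo Q} {u v : ℝ} (h : Relation.TransGen A.Step u v) :
    u ≤ v := by
  induction h with
  | single h => exact h.1
  | tail _ h ih => exact ih.trans h.1

theorem exists_forall_frequently_emb (hbqo : IsBqo fun p q : Q => p ≤ q) (P : ℕ → QCclo Q)
    (hP : ∀ n, (P n).dom = ∅ ∨ Nonempty (Decomp (P n))) :
    ∃ N, ∀ n, ∃ᶠ k in atTop, (P (n + N)).Emb (P (k + N)) := by
  obtain ⟨N, hN⟩ := exists_forall_frequently Emb P fun g _ => by
    by_cases h : ∃ i, (P (g i)).dom = ∅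
    · obtain ⟨i, hi⟩ := h
      exact ⟨i, i + 1, Nat.lt_succ_self i, Emb.of_empty hi _⟩
    · push Not at h
      exact Decomp.exists_emb hbqo _ fun n => (hP (g n)).resolve_left (h n).ne_empty
  refine ⟨N, fun n => Filter.frequently_atTop.2 fun M => ?_⟩
  obtain ⟨k, hk, h⟩ := Filter.frequently_atTop.1 (hN (n + N) (Nat.le_add_left _ _)) (M + N)
  refine ⟨k - N, by omega, ?_⟩
  rwa [Nat.sub_add_cancel (by omega)]

/-- A cclo with pieces accumulating at one point is eventually indecomposable around this point. -/
theorem exists_step_of_tendsto (hbqo : IsBqo fun p q : Q => p ≤ q) (A : QCclo Q) {x : ℝ}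
    (hx : x ∈ A.dom) {w z : ℕ → ℝ} (hw : ∀ n, A.Step (w n) (w (n + 1))) (hwx : ∀ n, w n < x)
    (hwt : Tendsto w atTop (𝓝 x)) (hz : ∀ n, A.Step (z (n + 1)) (z n)) (hzx : ∀ n, x < z n)
    (hzt : Tendsto z atTop (𝓝 x)) : ∃ N M, A.Step (w N) (z M) := by
  obtain ⟨N, hN⟩ := exists_forall_frequently_emb hbqo (fun n => A.between (w n) (w (n + 1)))
    fun n => (hw n).2.2.2
  obtain ⟨M, hM⟩ := exists_forall_frequently_emb hbqo (fun n => A.between (z (n + 1)) (z n))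
    fun n => (hz n).2.2.2
  have hwm : Monotone w := monotone_nat_of_le_succ fun n => (hw n).1
  have hzm : Antitone z := antitone_nat_of_succ_le fun n => (hz n).1
  obtain ⟨h1, h2⟩ := convergesUp_inter_Icc (V := A.dom) (w := fun n => w (n + N))
    (fun i j h => hwm (by omega)) (fun n => (hw _).2.1) (fun n => hwx _)
    ((tendsto_add_atTop_iff_nat N).2 hwt)
  obtain ⟨h3, h4⟩ := convergesDown_inter_Icc (V := A.dom) (w := fun n => z (n + M))
    (fun i j h => hzm (by omega)) (fun n => (hz _).2.2.1) (fun n => hzx _)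
    ((tendsto_add_atTop_iff_nat M).2 hzt)
  simp only [add_right_comm _ 1, zero_add] at h1 h2 h3 h4
  refine ⟨N, M, ((hwx N).trans (hzx M)).le, (hw N).2.1, (hz M).2.2.1, Or.inr ⟨?_⟩⟩
  refine Decomp.mk (fun n => A.between (w (n + N)) (w (n + N + 1)))
    (fun n => A.between (z (n + M + 1)) (z (n + M))) (A.val x) x
    ⟨h1, h3, ?_, fun _ _ _ => rfl, fun _ _ _ => rfl, rfl⟩ hN hM
    (fun n h => ((hw _).2.2.2.resolve_left h.ne_empty).some)
    (fun n h => ((hz _).2.2.2.resolve_left h.ne_empty).some)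
  change A.dom ∩ Icc (w N) (z M) = (⋃ n, A.dom ∩ Icc (w (n + N)) (w (n + N + 1))) ∪ {x} ∪
    ⋃ n, A.dom ∩ Icc (z (n + M + 1)) (z (n + M))
  rw [h2, h4]
  have h5 := hwx N
  have h6 := hzx M
  ext y
  simp only [mem_inter_iff, mem_Icc, mem_union, mem_Ico, mem_Ioc, mem_singleton_iff]
  constructor
  · rintro ⟨h7, h8, h9⟩
    rcases lt_trichotomy y x with h | h | h
    · exact Or.inl (Or.inl ⟨h7, h8, h⟩)
    · exact Or.inl (Or.inr h)
    · exact Or.inr ⟨h7, h, h9⟩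
  · rintro ((⟨h7, h8, h9⟩ | rfl) | ⟨h7, h8, h9⟩)
    · exact ⟨h7, h8, (h9.trans h6).le⟩
    · exact ⟨hx, h5.le, h6.le⟩
    · exact ⟨h7, (h5.trans h8).le, h9⟩

/-- Near `x`, any two points outside `A.dom` are joined by a chain of steps. -/
def LocallyGood (A : QCclo Q) (x : ℝ) : Prop :=
  ∃ s t, s < x ∧ x < t ∧ ∀ a ∈ Ioo s t, ∀ b ∈ Ioo s t, a ∉ A.dom → b ∉ A.dom → a ≤ b →
    Relation.TransGen A.Step a b

theorem isOpen_locallyGood (A : QCclo Q) : IsOpen {x | A.LocallyGood x} := by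
  refine isOpen_iff_mem_nhds.2 ?_
  rintro x ⟨s, t, hs, ht, h⟩
  filter_upwards [Ioo_mem_nhds hs ht] with y hy
  exact ⟨s, t, hy.1, hy.2, h⟩

theorem locallyGood_of_notMem (A : QCclo Q) {x : ℝ} (hx : x ∉ A.dom) : A.LocallyGood x := by
  obtain ⟨s, t, ⟨hs, ht⟩, hst⟩ :=
    mem_nhds_iff_exists_Ioo_subset.1 (A.dom_closed.isOpen_compl.mem_nhds hx)
  refine ⟨s, t, hs, ht, fun a ha b hb haV hbV hab => Relation.TransGen.single
    ⟨hab, haV, hbV, Or.inl (eq_empty_iff_forall_notMem.2 ?_)⟩⟩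
  rintro y ⟨hy, h1, h2⟩
  exact hst ⟨ha.1.trans_le h1, h2.trans_lt hb.2⟩ hy

theorem transGen_of_locallyGood (A : QCclo Q) {a b : ℝ} (hab : a ≤ b) (ha : a ∉ A.dom)
    (hb : b ∉ A.dom) (h : ∀ x ∈ Icc a b, A.LocallyGood x) : Relation.TransGen A.Step a b := by
  let S := {d | d ∈ Icc a b ∧ d ∉ A.dom ∧ Relation.TransGen A.Step a d}
  have haS : a ∈ S := by
    obtain ⟨s, t, hs, ht, hg⟩ := h a ⟨le_rfl, hab⟩
    exact ⟨⟨le_rfl, hab⟩, ha, hg a ⟨hs, ht⟩ a ⟨hs, ht⟩ ha ha le_rfl⟩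
  have hSb : BddAbove S := ⟨b, fun d hd => hd.1.2⟩
  have hz1 : a ≤ sSup S := le_csSup hSb haS
  have hz2 : sSup S ≤ b := csSup_le ⟨a, haS⟩ fun d hd => hd.1.2
  obtain ⟨s, t, hs, ht, hg⟩ := h _ ⟨hz1, hz2⟩
  obtain ⟨d, hd, hsd⟩ := exists_lt_of_lt_csSup ⟨a, haS⟩ hs
  have hdz : d ≤ sSup S := le_csSup hSb hd
  rcases hz2.eq_or_lt with h1 | h1
  · rw [h1] at hdz ht hs
    exact hd.2.2.trans (hg d ⟨hsd, hdz.trans_lt ht⟩ b ⟨hs, ht⟩ hd.2.1 hb hdz)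
  · exfalso
    obtain ⟨e, he, h2, h3⟩ := (A.dom_countable.dense_compl ℝ).exists_between (lt_min h1 ht)
    have h4 := lt_min_iff.1 h3
    have heS : e ∈ S := ⟨⟨hz1.trans h2.le, h4.1.le⟩, he, hd.2.2.trans
      (hg d ⟨hsd, hdz.trans_lt ht⟩ e ⟨hs.trans h2, h4.2⟩ hd.2.1 he (hdz.trans h2.le))⟩
    exact (le_csSup hSb heS).not_gt h2

/-- Any two points outside `A.dom` are joined by a chain of steps. -/
theorem transGen_step (hbqo : IsBqo fun p q : Q => p ≤ q) (A : QCclo Q) {a b : ℝ} (hab : a ≤ b)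
    (ha : a ∉ A.dom) (hb : b ∉ A.dom) : Relation.TransGen A.Step a b := by
  refine A.transGen_of_locallyGood hab ha hb fun y _ => ?_
  by_contra hy
  have hsub : {x | A.LocallyGood x}ᶜ ⊆ A.dom := fun x hx => by
    by_contra hxV
    exact hx (A.locallyGood_of_notMem hxV)
  obtain ⟨x, hxF, U, hU, hUx⟩ := exists_not_accPt A.isOpen_locallyGood.isClosed_compl
    (A.dom_countable.mono hsub) ⟨y, hy⟩
  have hxV := hsub hxF
  obtain ⟨s, t, ⟨hs, ht⟩, hst⟩ := mem_nhds_iff_exists_Ioo_subset.1 hU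
  have hgood : ∀ a b, s < a → b < t → a ∉ A.dom → b ∉ A.dom → a ≤ b → (b < x ∨ x < a) →
      Relation.TransGen A.Step a b := by
    intro a b hsa hbt ha hb hab hx
    refine A.transGen_of_locallyGood hab ha hb fun z hz => ?_
    by_contra hz'
    have h1 := hUx z (hst ⟨hsa.trans_le hz.1, hz.2.trans_lt hbt⟩) hz'
    rcases hx with h2 | h2
    · exact (h1 ▸ hz.2).not_gt h2
    · exact (h1 ▸ hz.1).not_gt h2
  refine hxF ⟨s, t, hs, ht, fun a haI b hbI ha hb hab => ?_⟩
  rcases lt_trichotomy b x with hbx | rfl | hbx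
  · exact hgood a b haI.1 hbI.2 ha hb hab (Or.inl hbx)
  · exact absurd hxV hb
  rcases lt_trichotomy a x with hax | rfl | hax
  rotate_left
  · exact absurd hxV ha
  · exact hgood a b haI.1 hbI.2 ha hb hab (Or.inr hax)
  have hdense := A.dom_countable.dense_compl ℝ
  obtain ⟨u, hu, huI, hut⟩ := hdense.exists_seq_strictMono_tendsto_of_lt hax
  obtain ⟨v, hv, hvI, hvt⟩ := hdense.exists_seq_strictAnti_tendsto_of_lt hbx
  obtain ⟨w, hw0, hw, hwu⟩ := exists_sequence_of_transGen (r := A.Step) u fun n =>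
    hgood _ _ (haI.1.trans (huI n).1.1) ((huI (n + 1)).1.2.trans ht) (huI n).2 (huI (n + 1)).2
      (hu (Nat.lt_succ_self n)).le (Or.inl (huI (n + 1)).1.2)
  obtain ⟨z, hz0, hz, hzv⟩ := exists_sequence_of_transGen (r := fun p q => A.Step q p) v fun n =>
    Relation.transGen_swap.2 <|
    hgood _ _ (hs.trans (hvI (n + 1)).1.1) ((hvI n).1.2.trans hbI.2) (hvI (n + 1)).2 (hvI n).2
      (hv (Nat.lt_succ_self n)).le (Or.inr (hvI (n + 1)).1.1)
  obtain ⟨hw1, hw2⟩ := Monotone.tendsto_of_cofinal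
    (monotone_nat_of_le_succ fun n => (hw n).1) (fun n => (huI n).1.2) hut hwu
  obtain ⟨hz1, hz2⟩ := Antitone.tendsto_of_cofinal
    (antitone_nat_of_succ_le fun n => (hz n).1) (fun n => (hvI n).1.1) hvt hzv
  obtain ⟨N, M, hNM⟩ := exists_step_of_tendsto hbqo A hxV hw hw1 hw2 hz hz1 hz2
  have hwa : a ≤ w N := (huI 0).1.1.le.trans
    (hw0 ▸ monotone_nat_of_le_succ (fun n => (hw n).1) (Nat.zero_le N))
  have hzb : z M ≤ b := le_trans
    (hz0 ▸ antitone_nat_of_succ_le (fun n => (hz n).1) (Nat.zero_le M)) (hvI 0).1.2.le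
  exact ((hgood a (w N) haI.1 ((hw1 N).trans ht) ha hNM.2.1 hwa (Or.inl (hw1 N))).tail hNM).trans
    (hgood (z M) b (hs.trans (hz1 M)) hbI.2 hNM.2.2.1 hb hzb (Or.inr (hz1 M)))

/-- `A` is the concatenation of a finite list of cclos. -/
inductive IsListSum : List (QCclo Q) → QCclo Q → Prop
  | nil {A : QCclo Q} (h : A.dom = ∅) : IsListSum [] A
  | cons {A B C : QCclo Q} {l : List (QCclo Q)} (h : A.IsConcat fun i => cond i C B)
      (hl : IsListSum l C) : IsListSum (B :: l) A

theorem IsListSum.emb {l l' : List (QCclo Q)} (h : List.SublistForall₂ Emb l l')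
    {A A' : QCclo Q} (hA : IsListSum l A) (hA' : IsListSum l' A') : A.Emb A' := by
  induction h generalizing A A' with
  | nil =>
    cases hA with
    | nil h => exact Emb.of_empty h _
  | cons hB _ ih =>
    cases hA with
    | cons h hl =>
      cases hA' with
      | cons h' hl' =>
        refine h.emb h' fun i => ?_
        cases i
        exacts [hB, ih hl hl']
  | cons_right _ ih =>
    cases hA' with
    | cons h' hl' =>
      refine (ih hA hl').trans (Emb.of_subset ?_ (h'.val_eq true))
      rw [h'.dom_eq]
      exact subset_iUnion_of_subset true Subset.rfl

theorem exists_isListSum_between {A : QCclo Q} {u v : ℝ} (h : Relation.TransGen A.Step u v) :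
    ∃ l : List (QCclo Q), (∀ B ∈ l, Nonempty (Decomp B)) ∧ IsListSum l (A.between u v) := by
  induction h using Relation.TransGen.head_induction_on with
  | @single u h =>
    rcases h.2.2.2 with h1 | h1
    · exact ⟨[], by simp, .nil h1⟩
    · refine ⟨[A.between u v], by simpa using h1, .cons (A.isConcat_between h.1 le_rfl h.2.2.1)
        (.nil (eq_empty_iff_forall_notMem.2 ?_))⟩
      rintro y ⟨hy, h2, h3⟩
      exact h.2.2.1 (le_antisymm h2 h3 ▸ hy)
  | @head u c h hcv ih =>
    obtain ⟨l, hl, hls⟩ := ih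
    have hc := A.isConcat_between h.1 (Step.le_of_transGen hcv) h.2.2.1
    rcases h.2.2.2 with h1 | h1
    · refine ⟨l, hl, ?_⟩
      have : A.between u v = A.between c v := by
        have h2 : (A.between u v).dom = (A.between c v).dom := by
          rw [hc.dom_eq]
          ext y
          simp [Bool.exists_bool, h1]
        simpa [between, restr] using h2
      rwa [this]
    · exact ⟨A.between u c :: l, by simpa using ⟨h1, hl⟩, .cons hc hls⟩

theorem exists_isListSum (hbqo : IsBqo fun p q : Q => p ≤ q) (A : QCclo Q) {a b : ℝ}
    (hab : A.dom ⊆ Icc a b) :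
    ∃ l : List (QCclo Q), (∀ B ∈ l, Nonempty (Decomp B)) ∧ IsListSum l A := by
  have h1 : A.between (min a b - 1) (b + 1) = A := by
    have h2 : A.dom ∩ Icc (min a b - 1) (b + 1) = A.dom := inter_eq_left.2 <| hab.trans <|
      Icc_subset_Icc (by linarith [min_le_left a b]) (by linarith)
    obtain ⟨V, hV, hVc, f⟩ := A
    simpa [between, restr] using h2
  rw [← h1]
  refine exists_isListSum_between (transGen_step hbqo A (by linarith [min_le_right a b]) ?_ ?_)
  · intro h
    linarith [(hab h).1, min_le_left a b]
  · intro h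
    linarith [(hab h).2]

end QCclo

/-! ### All cclos are well-quasi-ordered by embeddability -/

namespace QCclo

variable {Q : Type}

open Real in
/-- The cclo on `[-π/2, π/2]` obtained from `A` by the change of variables `arctan`, with two
end points labeled `q` added. -/
noncomputable def compactify (q : Q) (A : QCclo Q) : QCclo Q where
  dom := Icc (-(π / 2)) (π / 2) \ (Ioo (-(π / 2)) (π / 2) ∩ tan ⁻¹' A.domᶜ)
  dom_countable := by
    refine ((A.dom_countable.image arctan).union
      ((Set.finite_singleton (π / 2)).insert (-(π / 2))).countable).mono ?_
    rintro y ⟨hy, hy'⟩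
    by_cases h1 : y ∈ Ioo (-(π / 2)) (π / 2)
    · exact Or.inl ⟨tan y, not_not.1 fun h => hy' ⟨h1, h⟩, arctan_tan h1.1 h1.2⟩
    · refine Or.inr ?_
      rcases hy.1.eq_or_lt with h | h
      · exact Or.inl h.symm
      · exact Or.inr (le_antisymm hy.2 (not_lt.1 fun h2 => h1 ⟨h, h2⟩))
  dom_closed := isClosed_Icc.sdiff <|
    continuousOn_tan_Ioo.isOpen_inter_preimage isOpen_Ioo A.dom_closed.isOpen_compl
  val := by classical exact fun y => if y ∈ Ioo (-(π / 2)) (π / 2) then A.val (tan y) else q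

open Real in
theorem Emb.of_compactify [Preorder Q] {q : Q} {A B : QCclo Q}
    (h : (A.compactify q).Emb (B.compactify q)) : A.Emb B := by
  obtain ⟨g, ⟨hg, hmono, hcont⟩, hval⟩ := h
  have hlo : -(π / 2) ∈ (A.compactify q).dom :=
    ⟨⟨le_rfl, by linarith [pi_pos]⟩, fun h => lt_irrefl _ h.1.1⟩
  have hhi : π / 2 ∈ (A.compactify q).dom :=
    ⟨⟨by linarith [pi_pos], le_rfl⟩, fun h => lt_irrefl _ h.1.2⟩
  have harc : ∀ x ∈ A.dom, arctan x ∈ (A.compactify q).dom := fun x hx =>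
    ⟨Ioo_subset_Icc_self (arctan_mem_Ioo x), fun h => h.2 (by rwa [tan_arctan])⟩
  have hI : ∀ x ∈ A.dom, g (arctan x) ∈ Ioo (-(π / 2)) (π / 2) := fun x hx =>
    ⟨(hg _ hlo).1.1.trans_lt (hmono _ hlo _ (harc x hx) (neg_pi_div_two_lt_arctan x)),
      (hmono _ (harc x hx) _ hhi (arctan_lt_pi_div_two x)).trans_le (hg _ hhi).1.2⟩
  refine ⟨fun x => tan (g (arctan x)), ⟨fun x hx => ?_, fun x hx y hy hxy => ?_, ?_⟩,
    fun x hx => ?_⟩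
  · exact not_not.1 fun h => (hg _ (harc x hx)).2 ⟨hI x hx, h⟩
  · exact strictMonoOn_tan (hI x hx) (hI y hy)
      (hmono _ (harc x hx) _ (harc y hy) (arctan_strictMono hxy))
  · exact continuousOn_tan_Ioo.comp (hcont.comp continuous_arctan.continuousOn harc) hI
  · have h := hval _ (harc x hx)
    simp only [compactify, if_pos (arctan_mem_Ioo x), if_pos (hI x hx), tan_arctan] at h
    exact h

instance [Preorder Q] : IsPreorder (QCclo Q) Emb where
  refl := Emb.refl

theorem exists_emb_of_subset_Icc [Preorder Q] (hbqo : IsBqo fun p q : Q => p ≤ q) {a b : ℝ}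
    (f : ℕ → QCclo Q) (hf : ∀ n, (f n).dom ⊆ Icc a b) : ∃ i j, i < j ∧ (f i).Emb (f j) := by
  choose l hl hls using fun n => exists_isListSum hbqo (f n) (hf n)
  have hD : {B : QCclo Q | Nonempty (Decomp B)}.PartiallyWellOrderedOn Emb := fun g =>
    Decomp.exists_emb hbqo (fun n => (g n : QCclo Q)) fun n => (g n).2
  obtain ⟨i, j, hij, h⟩ :=
    Set.PartiallyWellOrderedOn.partiallyWellOrderedOn_sublistForall₂ Emb hD fun n => ⟨l n, hl n⟩
  exact ⟨i, j, hij, IsListSum.emb h (hls i) (hls j)⟩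

/-- Cclos with labels in a better quasi-order are well-quasi-ordered. -/
theorem exists_emb [Preorder Q] (hbqo : IsBqo fun p q : Q => p ≤ q) (f : ℕ → QCclo Q) :
    ∃ i j, i < j ∧ (f i).Emb (f j) := by
  obtain ⟨i, j, hij, h⟩ := exists_emb_of_subset_Icc hbqo
    (fun n => (f n).compactify ((f 0).val 0)) fun _ => sdiff_subset
  exact ⟨i, j, hij, h.of_compactify⟩

end QCclo

/-! ### Coding sequences by countably many finite data -/

theorem exists_countable_representatives {P K : Type*} [Countable K] {E : P → P → Prop}
    (C : P → K → Prop) {Y : Set P} (hC : ∀ A ∈ Y, ∃ k, C A k)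
    (hE : ∀ A B k, C A k → C B k → E A B) :
    ∃ S ⊆ Y, S.Countable ∧ ∀ A ∈ Y, ∃ B ∈ S, E A B := by
  choose rep hrep using fun k : {k // ∃ A ∈ Y, C A k} => k.2
  refine ⟨range rep, range_subset_iff.2 fun k => (hrep k).1, countable_range _, fun A hA => ?_⟩
  obtain ⟨k, hk⟩ := hC A hA
  exact ⟨_, mem_range_self ⟨k, A, hA, hk⟩, hE _ _ k hk (hrep _).2⟩

/-- In a well-quasi-order, a downward closed set is determined by finitely many obstructions. -/
theorem exists_finset_obstructions {P : Type*} {r : P → P → Prop}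
    (hr : ∀ f : ℕ → P, ∃ i j, i < j ∧ r (f i) (f j)) {D : Set P}
    (hD : ∀ s t, r s t → t ∈ D → s ∈ D) :
    ∃ F : Finset P, ∀ s, s ∈ D ↔ ∀ t ∈ F, ¬ r t s := by
  by_contra! h
  obtain ⟨f, -, hf⟩ := exists_seq_of_forall_finset_exists (fun s => s ∉ D) (fun s t => ¬ r s t)
    fun F hF => by
      obtain ⟨s, ⟨h1, t, h2, h3⟩ | ⟨h1, h2⟩⟩ := h F
      · exact absurd (hD _ _ h3 h1) (hF t h2)
      · exact ⟨s, h1, h2⟩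
  obtain ⟨i, j, hij, h⟩ := hr f
  exact hf i j hij h

/-- The countably many codes of sequences with representatives in `S`. -/
abbrev SeqCode {P : Type*} (S : Set P) := Σ N : ℕ, (Fin N → S) × Finset S

/-- `c` records representatives of an initial part of `L` and finitely many obstructions
describing the elements of `S` below the rest of `L`, which is unbounded. -/
structure IsSeqCode {P : Type*} (r : P → P → Prop) (S : Set P) (L : ℕ → P) (c : SeqCode S) :
    Prop where
  exists_rep : ∀ n, ∃ s : S, r (L n) s ∧ r s (L n)
  init : ∀ i : Fin c.1, r (L i) (c.2.1 i) ∧ r (c.2.1 i) (L i)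
  frequently : ∀ n, c.1 ≤ n → ∃ᶠ k in atTop, r (L n) (L k)
  below_iff : ∀ s : S, (∃ n, c.1 ≤ n ∧ r s (L n)) ↔ ∀ t ∈ c.2.2, ¬ r t s

theorem exists_isSeqCode {P : Type*} {r : P → P → Prop} [IsTrans P r]
    (hr : ∀ f : ℕ → P, ∃ i j, i < j ∧ r (f i) (f j)) {S : Set P} {L : ℕ → P}
    (hL : ∀ n, ∃ s ∈ S, r (L n) s ∧ r s (L n)) : ∃ c, IsSeqCode r S L c := by
  obtain ⟨N, hN⟩ := exists_forall_frequently r L fun g _ => hr _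
  choose s hs h1 h2 using hL
  obtain ⟨F, hF⟩ := exists_finset_obstructions (r := fun a b : S => r a b)
    (fun f => hr fun n => f n) (D := {s : S | ∃ n, N ≤ n ∧ r s (L n)}) <| by
      rintro s t hst ⟨n, hn, htn⟩
      exact ⟨n, hn, _root_.trans hst htn⟩
  exact ⟨⟨N, fun i => ⟨s i, hs i⟩, F⟩, fun n => ⟨⟨s n, hs n⟩, h1 n, h2 n⟩,
    fun i => ⟨h1 i, h2 i⟩, hN, hF⟩

theorem IsSeqCode.exists_strictMono {P : Type*} {r : P → P → Prop} [IsTrans P r] {S : Set P}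
    {L L' : ℕ → P} {c : SeqCode S} (h : IsSeqCode r S L c) (h' : IsSeqCode r S L' c) :
    ∃ k : ℕ → ℕ, StrictMono k ∧ ∀ n, r (L n) (L' (k n)) := by
  obtain ⟨N, l, F⟩ := c
  have hfreq : ∀ n, ∃ᶠ k in atTop, r (L (n + N)) (L' (k + N)) := by
    intro n
    obtain ⟨s, h1, h2⟩ := h.exists_rep (n + N)
    obtain ⟨m, hm, h3⟩ := (h'.below_iff s).2
      ((h.below_iff s).1 ⟨n + N, Nat.le_add_left N n, h2⟩)
    refine frequently_atTop.2 fun a => ?_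
    obtain ⟨b, hb, h4⟩ := frequently_atTop.1 (h'.frequently m hm) (a + N)
    refine ⟨b - N, by omega, ?_⟩
    rw [Nat.sub_add_cancel (by omega)]
    exact _root_.trans h1 (_root_.trans h3 h4)
  obtain ⟨φ, hφ, h1⟩ := extraction_forall_of_frequently hfreq
  refine ⟨fun n => if n < N then n else φ (n - N) + N, fun m n hmn => ?_, fun n => ?_⟩
  · simp only
    split_ifs with hm hn
    · exact hmn
    · omega
    · omega
    · exact Nat.add_lt_add_right (hφ (by omega)) N
  · by_cases hn : n < N
    · simp only [if_pos hn]
      exact _root_.trans (h.init ⟨n, hn⟩).1 (h'.init ⟨n, hn⟩).2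
    · have := h1 (n - N)
      rw [Nat.sub_add_cancel (by omega)] at this
      simpa only [if_neg hn] using this

/-! ### Sums of cclos with equal codes -/

theorem convergesUp_of_domLt {V : ℕ → Set ℝ} {x : ℝ}
    (hne : (∀ n, V n = ∅) ∨ ∀ n, (V n).Nonempty) (hlt : ∀ n, DomLt (V n) (V (n + 1)))
    (ht : ∀ a : ℕ → ℝ, (∀ n, a n ∈ V n) → Tendsto a atTop (𝓝 x)) : ConvergesUp V x := by
  rcases hne with h | h
  · obtain ⟨c, h1, h2, h3⟩ := exists_seq_strictMono_tendsto x
    exact ⟨c, h1.monotone, h2, h3, fun n => by simp [h n], fun n => by simp [h (n + 1)]⟩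
  · have hc : ∀ n, ∃ c : ℝ, (∀ a ∈ V n, a < c) ∧ ∀ b ∈ V (n + 1), c < b := fun n =>
      ((hlt n).resolve_left (h n).ne_empty).resolve_left (h (n + 1)).ne_empty
    choose c hc1 hc2 using hc
    choose a ha using h
    have hmono : StrictMono c := strictMono_nat_of_lt_succ fun n =>
      (hc2 n _ (ha (n + 1))).trans (hc1 (n + 1) _ (ha (n + 1)))
    have hlim : Tendsto c atTop (𝓝 x) :=
      tendsto_of_tendsto_of_tendsto_of_le_of_le (ht a ha) ((tendsto_add_atTop_iff_nat 1).2 (ht a ha))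
        (fun n => (hc1 n _ (ha n)).le) fun n => (hc2 n _ (ha (n + 1))).le
    exact ⟨c, hmono.monotone,
      fun n => (hmono n.lt_succ_self).trans_le (hmono.monotone.ge_of_tendsto hlim _), hlim, hc1, hc2⟩

theorem convergesDown_of_domLt {V : ℕ → Set ℝ} {x : ℝ}
    (hne : (∀ n, V n = ∅) ∨ ∀ n, (V n).Nonempty) (hlt : ∀ n, DomLt (V (n + 1)) (V n))
    (ht : ∀ a : ℕ → ℝ, (∀ n, a n ∈ V n) → Tendsto a atTop (𝓝 x)) : ConvergesDown V x := by
  refine convergesUp_of_domLt (hne.imp (fun h n => by simp [mirror, h n]) fun h n => ?_)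
    (fun n => ?_) fun a ha => ?_
  · obtain ⟨y, hy⟩ := h n
    exact ⟨-y, neg_mem_mirror.2 hy⟩
  · rcases hlt n with h | h | ⟨c, h1, h2⟩
    · exact Or.inr (Or.inl (by simp [mirror, h]))
    · exact Or.inl (by simp [mirror, h])
    · exact Or.inr (Or.inr ⟨-c, fun b hb => lt_neg.1 (h2 _ hb), fun b hb => neg_lt.1 (h1 _ hb)⟩)
  · simpa using (ht (fun n => -a n) ha).neg

namespace QCclo

variable {Q : Type}

theorem _root_.IsOmegaSum.isCenteredSum {L : QCclo Q} {Ls Rs : ℕ → QCclo Q} {p : Q} {x : ℝ}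
    (h : IsOmegaSum L Ls Rs p x) : L.IsCenteredSum Ls Rs p x := by
  obtain ⟨h1, h2, -, h3, -, h4, h5, h6, h7, h8, h9, h10⟩ := h
  exact ⟨convergesUp_of_domLt h1 h3 h5, convergesDown_of_domLt h2 h4 h6, h7, h8, h9, h10⟩

theorem _root_.IsFinSum.isConcat {L : QCclo Q} {n : ℕ} {Ls : Fin n → QCclo Q}
    (h : IsFinSum L n Ls) : L.IsConcat Ls :=
  ⟨h.2.2.2.1, h.2.2.2.2, h.2.2.1⟩

variable [Preorder Q]

/-- `k` codes `L` as a sum of cclos with representatives in `S`. -/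
def IsSumCode (S : Set (QCclo Q)) (L : QCclo Q) :
    (Σ n : ℕ, Fin n → S) ⊕ (SeqCode S × Q × SeqCode S) → Prop
  | .inl k => ∃ Ls, IsFinSum L k.1 Ls ∧ ∀ i, (Ls i).Equiv (k.2 i)
  | .inr k => ∃ Ls Rs x, IsOmegaSum L Ls Rs k.2.1 x ∧
      IsSeqCode Emb S Ls k.1 ∧ IsSeqCode Emb S Rs k.2.2

theorem IsSumCode.emb {S : Set (QCclo Q)} {L L' : QCclo Q}
    {k : (Σ n : ℕ, Fin n → S) ⊕ (SeqCode S × Q × SeqCode S)}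
    (h : IsSumCode S L k) (h' : IsSumCode S L' k) : L.Emb L' := by
  rcases k with k | k
  · obtain ⟨Ls, h1, h2⟩ := h
    obtain ⟨Ls', h1', h2'⟩ := h'
    exact h1.isConcat.emb h1'.isConcat fun i => (h2 i).1.trans (h2' i).2
  · obtain ⟨Ls, Rs, x, h1, h2, h3⟩ := h
    obtain ⟨Ls', Rs', x', h1', h2', h3'⟩ := h'
    exact h1.isCenteredSum.emb h1'.isCenteredSum le_rfl (h2.exists_strictMono h2')
      (h3.exists_strictMono h3')

theorem exists_isSumCode (hbqo : IsBqo fun p q : Q => p ≤ q) {O S : Set (QCclo Q)}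
    (hS : ∀ A ∈ O, ∃ B ∈ S, QCclo.Equiv A B) {L : QCclo Q} (hL : L ∈ SSum O) :
    ∃ k, IsSumCode S L k := by
  rcases hL with ⟨n, Ls, h, hO⟩ | ⟨Ls, Rs, p, x, h, hLs, hRs⟩
  · choose B hB hAB using fun i => hS _ (hO i)
    exact ⟨.inl ⟨n, fun i => ⟨B i, hB i⟩⟩, Ls, h, hAB⟩
  · obtain ⟨c, hc⟩ := exists_isSeqCode (exists_emb hbqo) fun n => hS _ (hLs n)
    obtain ⟨d, hd⟩ := exists_isSeqCode (exists_emb hbqo) fun n => hS _ (hRs n)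
    exact ⟨.inr (c, p, d), Ls, Rs, x, h, hc, hd⟩

/-- Up to equivalence, there are only countably many sums of members of `O`. -/
theorem exists_countable_representatives_of_subset_sSum [Countable Q]
    (hbqo : IsBqo fun p q : Q => p ≤ q) {O Y : Set (QCclo Q)}
    (hO : ∃ S ⊆ O, S.Countable ∧ ∀ A ∈ O, ∃ B ∈ S, QCclo.Equiv A B) (hY : Y ⊆ SSum O) :
    ∃ S ⊆ Y, S.Countable ∧ ∀ A ∈ Y, ∃ B ∈ S, QCclo.Equiv A B := by
  obtain ⟨S, -, hSc, hS⟩ := hO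
  have := hSc.to_subtype
  exact exists_countable_representatives (IsSumCode S)
    (fun A hA => exists_isSumCode hbqo hS (hY hA)) fun A B k h h' => ⟨h.emb h', h'.emb h⟩

end QCclo

/-- If the countable bqo `Q` and a set `𝒪` of `Q`-cclos with `𝒪/≡` countable are given,
then `S'(𝒪)/≡` and `S(𝒪)/≡` are countable. -/
theorem stmt9 (Q : Type) [Preorder Q] [Countable Q]
    (hbqo : IsBqo (fun p q : Q => p ≤ q))
    (O : Set (QCclo Q))
    (hO : ∃ S ⊆ O, S.Countable ∧ ∀ A ∈ O, ∃ B ∈ S, QCclo.Equiv A B) :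
    (∃ S ⊆ S'Sum O, S.Countable ∧ ∀ A ∈ S'Sum O, ∃ B ∈ S, QCclo.Equiv A B) ∧
    (∃ S ⊆ SSum O, S.Countable ∧ ∀ A ∈ SSum O, ∃ B ∈ S, QCclo.Equiv A B) := by
  exact ⟨QCclo.exists_countable_representatives_of_subset_sSum hbqo hO fun _ hL => by
      obtain ⟨Ls, Rs, p, x, h, hLs, hRs, -⟩ := hL
      exact Or.inr ⟨Ls, Rs, p, x, h, hLs, hRs⟩,
    QCclo.exists_countable_representatives_of_subset_sSum hbqo hO Subset.rfl⟩
end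

section
/- Let v be a valuation, φ a closed formula, and b a real number with v(φ) < b < 1 such that b is not among the values v(ψ) of subformulas ψ of φ with respect to M^v. Let v' be the valuation with the same universe as v defined on atomic subformulas ψ of φ (with respect to M^v) by v'(ψ) = v(ψ) if v(ψ) < b and v'(ψ) = 1 otherwise (and arbitrarily on all other atomic formulas). Then v'(φ) = v(φ). -/
open Set

/-- Formulas of a relational first-order language with countably many predicate
symbols (symbol `p` has arity `ar p`); variables are de Bruijn indices. -/
inductive GFormula (ar : ℕ → ℕ) : Type
  | bot : GFormula ar
  | atom (p : ℕ) (ts : Fin (ar p) → ℕ) : GFormula ar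
  | conj : GFormula ar → GFormula ar → GFormula ar
  | disj : GFormula ar → GFormula ar → GFormula ar
  | imp : GFormula ar → GFormula ar → GFormula ar
  | all : GFormula ar → GFormula ar
  | ex : GFormula ar → GFormula ar

/-- All free variables of the formula are `< k`. -/
def GFormula.VarsBelow {ar : ℕ → ℕ} : ℕ → GFormula ar → Prop
  | _, .bot => True
  | k, .atom _ ts => ∀ i, ts i < k
  | k, .conj φ ψ => φ.VarsBelow k ∧ ψ.VarsBelow k
  | k, .disj φ ψ => φ.VarsBelow k ∧ ψ.VarsBelow k
  | k, .imp φ ψ => φ.VarsBelow k ∧ ψ.VarsBelow k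
  | k, .all φ => φ.VarsBelow (k+1)
  | k, .ex φ => φ.VarsBelow (k+1)

/-- A closed formula (sentence). -/
def GFormula.IsClosedF {ar : ℕ → ℕ} (φ : GFormula ar) : Prop := φ.VarsBelow 0

/-- The syntactic subformulas of a formula. -/
def GFormula.Subfs {ar : ℕ → ℕ} : GFormula ar → Set (GFormula ar)
  | .bot => {.bot}
  | .atom p ts => {.atom p ts}
  | .conj φ ψ => insert (.conj φ ψ) (φ.Subfs ∪ ψ.Subfs)
  | .disj φ ψ => insert (.disj φ ψ) (φ.Subfs ∪ ψ.Subfs)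
  | .imp φ ψ => insert (.imp φ ψ) (φ.Subfs ∪ ψ.Subfs)
  | .all φ => insert (.all φ) φ.Subfs
  | .ex φ => insert (.ex φ) φ.Subfs

/-- A Gödel set: a closed subset of `[0,1]` containing `0` and `1`. -/
def GodelSet (V : Set ℝ) : Prop :=
  IsClosed V ∧ V ⊆ Set.Icc (0:ℝ) 1 ∧ (0:ℝ) ∈ V ∧ (1:ℝ) ∈ V

/-- A valuation into `V`: a nonempty universe `M` together with interpretations of
all predicate symbols, taking values in `V`. -/
structure GValuation (ar : ℕ → ℕ) (V : Set ℝ) where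
  M : Type
  ne : Nonempty M
  interp : ∀ p : ℕ, (Fin (ar p) → M) → ℝ
  interp_mem : ∀ p t, interp p t ∈ V

/-- Prepend a value to an environment. -/
def consEnv {M : Type} (m : M) (e : ℕ → M) : ℕ → M
  | 0 => m
  | n+1 => e n

/-- The Gödel value of a formula under a valuation and an environment. -/
noncomputable def geval {ar : ℕ → ℕ} {V : Set ℝ} (v : GValuation ar V) :
    (ℕ → v.M) → GFormula ar → ℝ
  | _, .bot => 0
  | e, .atom p ts => v.interp p (fun i => e (ts i))
  | e, .conj φ ψ => min (geval v e φ) (geval v e ψ)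
  | e, .disj φ ψ => max (geval v e φ) (geval v e ψ)
  | e, .imp φ ψ => if geval v e φ ≤ geval v e ψ then 1 else geval v e ψ
  | e, .all φ => sInf (Set.range fun m : v.M => geval v (consEnv m e) φ)
  | e, .ex φ => sSup (Set.range fun m : v.M => geval v (consEnv m e) φ)

/-- The value `v(φ)` of a closed formula. -/
noncomputable def GValuation.val {ar : ℕ → ℕ} {V : Set ℝ}
    (v : GValuation ar V) (φ : GFormula ar) : ℝ :=
  geval v (fun _ => Classical.choice v.ne) φ

/-- `‖φ‖_V`: the infimum of `v(φ)` over all valuations `v` into `V`. -/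
noncomputable def GNorm (ar : ℕ → ℕ) (V : Set ℝ) (φ : GFormula ar) : ℝ :=
  sInf (Set.range fun v : GValuation ar V => v.val φ)

/-- The Gödel logic of `V`: all closed formulas with `‖φ‖_V = 1`. -/
def GLogic (ar : ℕ → ℕ) (V : Set ℝ) : Set (GFormula ar) :=
  {φ | φ.IsClosedF ∧ GNorm ar V φ = 1}

/-- Formulas take values in `[0,1]` under a valuation into a subset of `[0,1]`. -/
lemma geval_mem_Icc {ar : ℕ → ℕ} {V : Set ℝ} (hV : V ⊆ Set.Icc (0:ℝ) 1)
    (v : GValuation ar V) (φ : GFormula ar) (e : ℕ → v.M) :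
    geval v e φ ∈ Set.Icc (0:ℝ) 1 := by
  have := v.ne
  induction φ generalizing e with
  | bot => simp [geval]
  | atom p ts => exact hV (v.interp_mem _ _)
  | conj φ ψ h₁ h₂ =>
    exact ⟨le_min (h₁ e).1 (h₂ e).1, (min_le_left _ _).trans (h₁ e).2⟩
  | disj φ ψ h₁ h₂ =>
    exact ⟨(h₁ e).1.trans (le_max_left _ _), max_le (h₁ e).2 (h₂ e).2⟩
  | imp φ ψ h₁ h₂ =>
    simp only [geval]
    split_ifs
    · simp
    · exact h₂ e
  | all φ h =>
    exact ⟨le_ciInf fun m => (h (consEnv m e)).1,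
      (ciInf_le ⟨0, by rintro _ ⟨m, rfl⟩; exact (h _).1⟩ (Classical.choice v.ne)).trans (h _).2⟩
  | ex φ h =>
    exact ⟨(h _).1.trans
      (le_ciSup (f := fun m : v.M => geval v (consEnv m e) φ)
        ⟨1, by rintro _ ⟨m, rfl⟩; exact (h _).2⟩ (Classical.choice v.ne)),
      ciSup_le fun m => (h (consEnv m e)).2⟩

/-- The map sending everything that is at least `b` to `1`. -/
noncomputable def cutOff (b x : ℝ) : ℝ := if x < b then x else 1

lemma cutOff_of_lt {b x : ℝ} (h : x < b) : cutOff b x = x := if_pos h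

lemma cutOff_of_le {b x : ℝ} (h : b ≤ x) : cutOff b x = 1 := if_neg h.not_gt

lemma le_cutOff {b x : ℝ} (h : x ≤ 1) : x ≤ cutOff b x := by
  unfold cutOff; split_ifs <;> linarith

lemma cutOff_le_one {b x : ℝ} (h : x ≤ 1) : cutOff b x ≤ 1 := by
  unfold cutOff; split_ifs <;> linarith

lemma cutOff_mono {b : ℝ} (hb : b < 1) : Monotone (cutOff b) := by
  intro x y h
  unfold cutOff; split_ifs <;> linarith

lemma cutOff_imp {b x y : ℝ} (hb : b < 1) :
    (if cutOff b x ≤ cutOff b y then 1 else cutOff b y) = cutOff b (if x ≤ y then 1 else y) := by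
  unfold cutOff; split_ifs <;> linarith

lemma iInf_cutOff {ι : Type*} [Nonempty ι] {b : ℝ} (hb : b < 1) {f : ι → ℝ}
    (hf : ∀ i, f i ∈ Set.Icc (0:ℝ) 1) : ⨅ i, cutOff b (f i) = cutOff b (⨅ i, f i) := by
  have hbdd : BddBelow (range f) := ⟨0, by rintro _ ⟨i, rfl⟩; exact (hf i).1⟩
  have hbdd' : BddBelow (range fun i => cutOff b (f i)) :=
    ⟨0, by rintro _ ⟨i, rfl⟩; exact (hf i).1.trans (le_cutOff (hf i).2)⟩
  refine le_antisymm ?_ (le_ciInf fun i => cutOff_mono hb (ciInf_le hbdd i))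
  rcases lt_or_ge (⨅ i, f i) b with h | h
  · rw [cutOff_of_lt h]
    refine le_of_forall_gt_imp_ge_of_dense fun c hc => ?_
    obtain ⟨i, hi⟩ := exists_lt_of_ciInf_lt (lt_min hc h)
    calc ⨅ i, cutOff b (f i) ≤ cutOff b (f i) := ciInf_le hbdd' i
      _ = f i := cutOff_of_lt (hi.trans_le (min_le_right _ _))
      _ ≤ c := hi.le.trans (min_le_left _ _)
  · rw [cutOff_of_le h]
    exact (ciInf_le hbdd' (Classical.arbitrary ι)).trans (cutOff_le_one (hf _).2)

lemma iSup_cutOff {ι : Type*} [Nonempty ι] {b : ℝ} (hb : b < 1) {f : ι → ℝ}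
    (hf : ∀ i, f i ∈ Set.Icc (0:ℝ) 1) (hne : ⨆ i, f i ≠ b) :
    ⨆ i, cutOff b (f i) = cutOff b (⨆ i, f i) := by
  have hbdd : BddAbove (range f) := ⟨1, by rintro _ ⟨i, rfl⟩; exact (hf i).2⟩
  have hbdd' : BddAbove (range fun i => cutOff b (f i)) :=
    ⟨1, by rintro _ ⟨i, rfl⟩; exact cutOff_le_one (hf i).2⟩
  refine le_antisymm (ciSup_le fun i => cutOff_mono hb (le_ciSup hbdd i)) ?_
  rcases hne.lt_or_gt with h | h
  · rw [cutOff_of_lt h]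
    exact ciSup_mono hbdd' fun i => le_cutOff (hf i).2
  · obtain ⟨i, hi⟩ := exists_lt_of_lt_ciSup h
    rw [cutOff_of_le h.le, ← cutOff_of_le hi.le]
    exact le_ciSup hbdd' i

lemma GFormula.self_mem_Subfs {ar : ℕ → ℕ} (φ : GFormula ar) : φ ∈ φ.Subfs := by
  cases φ <;> simp [GFormula.Subfs]

/-- Cutting off the atomic values at `b` cuts off the values of all formulas at `b`, as long as
`b` is not the value of a subformula. -/
lemma geval_cutOff {ar : ℕ → ℕ} {V : Set ℝ} (hV : V ⊆ Set.Icc (0:ℝ) 1)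
    (v : GValuation ar V) {b : ℝ} (hb0 : 0 < b) (hb1 : b < 1)
    (interp' : ∀ p : ℕ, (Fin (ar p) → v.M) → ℝ) (hmem : ∀ p t, interp' p t ∈ V)
    (φ : GFormula ar) (hbnot : ∀ ψ ∈ φ.Subfs, ∀ e : ℕ → v.M, geval v e ψ ≠ b)
    (hatom : ∀ (p : ℕ) (ts : Fin (ar p) → ℕ), GFormula.atom p ts ∈ φ.Subfs →
      ∀ e : ℕ → v.M, interp' p (fun i => e (ts i)) = cutOff b (v.interp p (fun i => e (ts i))))
    (e : ℕ → v.M) :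
    geval (GValuation.mk v.M v.ne interp' hmem) e φ = cutOff b (geval v e φ) := by
  have := v.ne
  induction φ generalizing e with
  | bot => exact (cutOff_of_lt hb0).symm
  | atom p ts => exact hatom p ts (GFormula.self_mem_Subfs _) e
  | conj φ ψ h₁ h₂ =>
    simp only [geval]
    rw [h₁ (fun χ hχ => hbnot χ (.inr (.inl hχ))) fun p ts h => hatom p ts (.inr (.inl h)),
      h₂ (fun χ hχ => hbnot χ (.inr (.inr hχ))) fun p ts h => hatom p ts (.inr (.inr h)),
      (cutOff_mono hb1).map_min]
  | disj φ ψ h₁ h₂ =>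
    simp only [geval]
    rw [h₁ (fun χ hχ => hbnot χ (.inr (.inl hχ))) fun p ts h => hatom p ts (.inr (.inl h)),
      h₂ (fun χ hχ => hbnot χ (.inr (.inr hχ))) fun p ts h => hatom p ts (.inr (.inr h)),
      (cutOff_mono hb1).map_max]
  | imp φ ψ h₁ h₂ =>
    simp only [geval]
    rw [h₁ (fun χ hχ => hbnot χ (.inr (.inl hχ))) fun p ts h => hatom p ts (.inr (.inl h)),
      h₂ (fun χ hχ => hbnot χ (.inr (.inr hχ))) fun p ts h => hatom p ts (.inr (.inr h)),
      cutOff_imp hb1]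
  | all φ h =>
    simp only [geval]
    simp_rw [h (fun χ hχ => hbnot χ (.inr hχ)) fun p ts h => hatom p ts (.inr h)]
    exact iInf_cutOff hb1 fun m => geval_mem_Icc hV v φ (consEnv m e)
  | ex φ h =>
    simp only [geval]
    simp_rw [h (fun χ hχ => hbnot χ (.inr hχ)) fun p ts h => hatom p ts (.inr h)]
    exact iSup_cutOff hb1 (fun m => geval_mem_Icc hV v φ (consEnv m e))
      (hbnot _ (GFormula.self_mem_Subfs _) e)

/-- Valuation cut-off lemma: if `v(φ) < b < 1` and `b` is not the value of any
subformula of `φ` (w.r.t. `M^v`), then changing the atomic values `≥ b` to `1`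
(and arbitrarily changing atoms not occurring in `φ`) does not change `v(φ)`. -/
theorem stmt11 (ar : ℕ → ℕ) (V : Set ℝ) (hV : GodelSet V)
    (v : GValuation ar V) (φ : GFormula ar) (hφ : φ.IsClosedF) (b : ℝ)
    (hb1 : v.val φ < b) (hb2 : b < 1)
    (hbnot : ∀ ψ ∈ φ.Subfs, ∀ e : ℕ → v.M, geval v e ψ ≠ b)
    (interp' : ∀ p : ℕ, (Fin (ar p) → v.M) → ℝ)
    (hmem : ∀ p t, interp' p t ∈ V)
    (hatom : ∀ (p : ℕ) (ts : Fin (ar p) → ℕ), GFormula.atom p ts ∈ φ.Subfs →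
      ∀ e : ℕ → v.M, interp' p (fun i => e (ts i)) =
        if v.interp p (fun i => e (ts i)) < b then v.interp p (fun i => e (ts i)) else 1) :
    (GValuation.mk v.M v.ne interp' hmem).val φ = v.val φ := by
  have h0 : 0 < b := (geval_mem_Icc hV.2.1 v φ _).1.trans_lt hb1
  exact (geval_cutOff hV.2.1 v h0 hb2 interp' hmem φ hbnot hatom _).trans (cutOff_of_lt hb1)
end

section
/- Let M ⊆ ℝ be a countable set and P ⊆ ℝ a nonempty perfect set. Then there exists a strictly monotone map from M into P which is continuous on M (i.e. an smc-embedding of M into P). -/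
open Set Filter Topology

theorem Perfect.not_countable {α : Type*} [MetricSpace α] [CompleteSpace α] {C : Set α}
    (hC : Perfect C) (hne : C.Nonempty) : ¬ C.Countable := by
  intro hcount
  obtain ⟨f, hfC, -, hf⟩ := hC.exists_nat_bool_injection hne
  have : Countable (range f) := (hcount.mono hfC).to_subtype
  have : Countable (ℕ → Bool) := (rangeFactorization_injective.2 hf).countable
  have hcard := Cardinal.mk_le_aleph0 (α := ℕ → Bool)
  simp only [Cardinal.mk_pi, Cardinal.mk_bool, Cardinal.prod_const', Cardinal.mk_nat] at hcard
  exact (Cardinal.cantor _).not_ge hcard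

/-- The points of `P` which are limits of points of `P` from the right. -/
def rightLimitPoints (P : Set ℝ) : Set ℝ := {x ∈ P | 𝓝[P ∩ Ioi x] x ≠ ⊥}

/-- Every open set meeting a perfect set contains a right limit point of that set. -/
theorem Perfect.exists_mem_rightLimitPoints {P U : Set ℝ} (hP : Perfect P) (hU : IsOpen U)
    (h : (U ∩ P).Nonempty) : ∃ x ∈ U, x ∈ rightLimitPoints P := by
  obtain ⟨z, hzU, hzP⟩ := h
  obtain ⟨ε, hε, hεU⟩ := Metric.nhds_basis_closedBall.mem_iff.1 (hU.mem_nhds hzU)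
  obtain ⟨hperf, hne⟩ :=
    hP.closure_nhds_inter z hzP (Metric.mem_ball_self hε) Metric.isOpen_ball
  by_contra! hcon
  refine hperf.not_countable hne
    ((countable_setOfPred_isolated_right_within (s := P)).mono fun x hx ↦ ?_)
  have hxP : x ∈ P := closure_minimal inter_subset_right hP.closed hx
  have hxU : x ∈ U := hεU <| closure_minimal
    (inter_subset_left.trans Metric.ball_subset_closedBall) Metric.isClosed_closedBall hx
  refine ⟨hxP, ?_⟩
  by_contra hbot
  exact hcon x hxU ⟨hxP, hbot⟩

theorem Perfect.exists_rightLimitPoints_between {P : Set ℝ} (hP : Perfect P) {x y : ℝ}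
    (hx : x ∈ rightLimitPoints P) (hxy : x < y) :
    ∃ z ∈ Ioo x y, z ∈ rightLimitPoints P := by
  have : NeBot (𝓝[P ∩ Ioi x] x) := ⟨hx.2⟩
  obtain ⟨w, ⟨hwP, hxw⟩, hwy⟩ :=
    Filter.nonempty_of_mem (f := 𝓝[P ∩ Ioi x] x) (Filter.inter_mem self_mem_nhdsWithin
      (mem_nhdsWithin_of_mem_nhds (Iio_mem_nhds hxy)))
  exact hP.exists_mem_rightLimitPoints isOpen_Ioo ⟨w, ⟨hxw, hwy⟩, hwP⟩

/-- The rationals embed, as an ordered set, into every nonempty perfect set of reals. -/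
theorem Perfect.exists_strictMono_rat {P : Set ℝ} (hP : Perfect P) (hne : P.Nonempty) :
    ∃ e : ℚ → ℝ, StrictMono e ∧ ∀ q, e q ∈ P := by
  have hdense : DenselyOrdered (rightLimitPoints P) := ⟨fun x y hxy ↦ by
    obtain ⟨z, hz, hzP⟩ := hP.exists_rightLimitPoints_between x.2 hxy
    exact ⟨⟨z, hzP⟩, hz.1, hz.2⟩⟩
  have hnontriv : Nontrivial (rightLimitPoints P) := by
    obtain ⟨x, -, hx⟩ := hP.exists_mem_rightLimitPoints isOpen_univ (by simpa using hne)
    obtain ⟨z, hz, hzP⟩ := hP.exists_rightLimitPoints_between hx (lt_add_one x)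
    exact ⟨⟨x, hx⟩, ⟨z, hzP⟩, fun h ↦ hz.1.ne (congrArg Subtype.val h)⟩
  obtain ⟨e⟩ := Order.embedding_from_countable_to_dense ℚ (rightLimitPoints P)
  exact ⟨fun q ↦ e q, fun _ _ h ↦ e.strictMono h, fun q ↦ (e q).2.1⟩

/-- The real line embeds, as an ordered set, into every nonempty perfect set of reals. -/
theorem Perfect.exists_strictMono_real {P : Set ℝ} (hP : Perfect P) (hne : P.Nonempty) :
    ∃ f : ℝ → ℝ, StrictMono f ∧ ∀ x, f x ∈ P := by
  obtain ⟨e, he, heP⟩ := hP.exists_strictMono_rat hne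
  let S (x : ℝ) : Set ℝ := e '' {q : ℚ | (q : ℝ) < x}
  have hS (x : ℝ) : (S x).Nonempty := by
    obtain ⟨q, hq⟩ := exists_rat_lt x
    exact ⟨e q, mem_image_of_mem e hq⟩
  have hle {x : ℝ} {r : ℚ} (hr : x < r) : e r ∈ upperBounds (S x) := by
    rintro _ ⟨q, hq, rfl⟩
    exact he.monotone (by exact_mod_cast (lt_trans hq hr).le)
  have hbdd (x : ℝ) : BddAbove (S x) := by
    obtain ⟨r, hr⟩ := exists_rat_gt x
    exact ⟨e r, hle hr⟩
  refine ⟨fun x ↦ sSup (S x), fun x y hxy ↦ ?_, fun x ↦ ?_⟩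
  · obtain ⟨q, hxq, hqy⟩ := exists_rat_btwn hxy
    obtain ⟨r, hqr, hry⟩ := exists_rat_btwn hqy
    calc sSup (S x) ≤ e q := csSup_le (hS x) (hle hxq)
      _ < e r := he (by exact_mod_cast hqr)
      _ ≤ sSup (S y) := le_csSup (hbdd y) (mem_image_of_mem e hry)
  · refine closure_minimal ?_ hP.closed (csSup_mem_closure (hS x) (hbdd x))
    rintro _ ⟨q, -, rfl⟩
    exact heP q

/-- Two countable sets of reals can be made disjoint by translating one of them. -/
theorem Set.exists_add_notMem_of_countable {M D : Set ℝ} (hM : M.Countable) (hD : D.Countable) :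
    ∃ t : ℝ, ∀ x ∈ M, x + t ∉ D := by
  have hcount : (image2 (fun d x ↦ d - x) D M).Countable := hD.image2 hM _
  obtain ⟨t, ht⟩ := (hcount.dense_compl ℝ).nonempty
  exact ⟨t, fun x hx hxt ↦ ht ⟨x + t, hxt, x, hx, by ring⟩⟩


/-- Every countable set `M ⊆ ℝ` admits a strictly monotone map into a nonempty
perfect set `P ⊆ ℝ` which is continuous on `M` (an smc-embedding of `M` into `P`). -/
theorem stmt12 (M P : Set ℝ) (hM : M.Countable)
    (hP : Perfect P) (hPne : P.Nonempty) :
    ∃ h : ℝ → ℝ, (∀ x ∈ M, h x ∈ P) ∧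
      (∀ x ∈ M, ∀ y ∈ M, x < y → h x < h y) ∧
      ContinuousOn h M := by
  obtain ⟨f, hf, hfP⟩ := hP.exists_strictMono_real hPne
  obtain ⟨t, ht⟩ := exists_add_notMem_of_countable hM hf.monotone.countable_not_continuousAt
  refine ⟨fun x ↦ f (x + t), fun x _ ↦ hfP _, fun x _ y _ hxy ↦ hf (by simpa using hxy),
    fun x hx ↦ ContinuousAt.continuousWithinAt ?_⟩
  have hcont : ContinuousAt f (x + t) := not_not.1 (ht x hx)
  exact hcont.comp (f := fun y ↦ y + t) (by fun_prop)
end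

section
/- Let V₁ and V₂ be Gödel sets and suppose there exists a strictly monotone map h : V₁ → V₂, continuous on V₁, with h(0) = 0 and h(1) = 1. Then the Gödel logic determined by V₁ is a superset of the Gödel logic determined by V₂: G_{V₂} ⊆ G_{V₁}. -/
open Set

lemma GodelSet.csInf_mem {V : Set ℝ} (hV : GodelSet V) {s : Set ℝ} (hs : s ⊆ V)
    (hne : s.Nonempty) : sInf s ∈ V :=
  closure_minimal hs hV.1 (csInf_mem_closure hne (bddBelow_Icc.mono (hs.trans hV.2.1)))

lemma GodelSet.csSup_mem {V : Set ℝ} (hV : GodelSet V) {s : Set ℝ} (hs : s ⊆ V)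
    (hne : s.Nonempty) : sSup s ∈ V :=
  closure_minimal hs hV.1 (csSup_mem_closure hne (bddAbove_Icc.mono (hs.trans hV.2.1)))

lemma geval_mem {ar : ℕ → ℕ} {V : Set ℝ} (hV : GodelSet V) (v : GValuation ar V)
    (φ : GFormula ar) (e : ℕ → v.M) : geval v e φ ∈ V := by
  have : Nonempty v.M := v.ne
  induction φ generalizing e with
  | bot => exact hV.2.2.1
  | atom p ts => exact v.interp_mem _ _
  | conj φ ψ hφ hψ => exact min_rec' (· ∈ V) (hφ e) (hψ e)
  | disj φ ψ hφ hψ => exact max_rec' (· ∈ V) (hφ e) (hψ e)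
  | imp φ ψ _ hψ =>
    rw [geval]
    split_ifs
    exacts [hV.2.2.2, hψ e]
  | all φ hφ => exact hV.csInf_mem (range_subset_iff.2 fun _ => hφ _) (range_nonempty _)
  | ex φ hφ => exact hV.csSup_mem (range_subset_iff.2 fun _ => hφ _) (range_nonempty _)

lemma gNorm_eq_one_iff {ar : ℕ → ℕ} {V : Set ℝ} (hV : GodelSet V) (φ : GFormula ar) :
    GNorm ar V φ = 1 ↔ ∀ v : GValuation ar V, v.val φ = 1 := by
  have hmem (v : GValuation ar V) : v.val φ ∈ Icc (0 : ℝ) 1 := hV.2.1 (geval_mem hV v φ _)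
  have : Nonempty (GValuation ar V) := ⟨⟨Unit, ⟨()⟩, fun _ _ => 0, fun _ _ => hV.2.2.1⟩⟩
  constructor
  · intro hφ v
    refine le_antisymm (hmem v).2 (hφ.ge.trans (csInf_le ⟨0, ?_⟩ (mem_range_self v)))
    rintro _ ⟨w, rfl⟩
    exact (hmem w).1
  · intro hφ
    simp [GNorm, hφ]

/-- The valuation obtained by applying a map `h : V₁ → V₂` to all atomic values. -/
def GValuation.map {ar : ℕ → ℕ} {V₁ V₂ : Set ℝ} (v : GValuation ar V₁) (h : ℝ → ℝ)
    (hmap : ∀ x ∈ V₁, h x ∈ V₂) : GValuation ar V₂ where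
  M := v.M
  ne := v.ne
  interp p t := h (v.interp p t)
  interp_mem p t := hmap _ (v.interp_mem p t)

lemma geval_map {ar : ℕ → ℕ} {V₁ V₂ : Set ℝ} (hV₁ : GodelSet V₁) {h : ℝ → ℝ}
    (hmap : ∀ x ∈ V₁, h x ∈ V₂) (hmono : StrictMonoOn h V₁) (hcont : ContinuousOn h V₁)
    (h0 : h 0 = 0) (h1 : h 1 = 1) (v : GValuation ar V₁) (φ : GFormula ar) (e : ℕ → v.M) :
    geval (v.map h hmap) e φ = h (geval v e φ) := by
  have : Nonempty v.M := v.ne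
  have hmem := geval_mem hV₁ v
  induction φ generalizing e with
  | bot => exact h0.symm
  | atom p ts => rfl
  | conj φ ψ hφ hψ =>
    simp only [geval, hφ, hψ]
    exact (hmono.monotoneOn.map_min (hmem φ e) (hmem ψ e)).symm
  | disj φ ψ hφ hψ =>
    simp only [geval, hφ, hψ]
    exact (hmono.monotoneOn.map_max (hmem φ e) (hmem ψ e)).symm
  | imp φ ψ hφ hψ =>
    simp only [geval, hφ, hψ, hmono.le_iff_le (hmem φ e) (hmem ψ e), apply_ite h, h1]
  | all φ hφ =>
    have hs : range (fun m => geval v (consEnv m e) φ) ⊆ V₁ :=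
      range_subset_iff.2 fun _ => hmem φ _
    have hne := range_nonempty fun m => geval v (consEnv m e) φ
    simp only [geval]
    rw [MonotoneOn.map_csInf_of_continuousWithinAt
      ((hcont _ (hV₁.csInf_mem hs hne)).mono hs) (hmono.monotoneOn.mono hs) hne
      (bddBelow_Icc.mono (hs.trans hV₁.2.1)), ← range_comp]
    exact congrArg (fun f => sInf (range f)) (funext fun m => hφ (consEnv m e))
  | ex φ hφ =>
    have hs : range (fun m => geval v (consEnv m e) φ) ⊆ V₁ :=
      range_subset_iff.2 fun _ => hmem φ _
    have hne := range_nonempty fun m => geval v (consEnv m e) φ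
    simp only [geval]
    rw [MonotoneOn.map_csSup_of_continuousWithinAt
      ((hcont _ (hV₁.csSup_mem hs hne)).mono hs) (hmono.monotoneOn.mono hs) hne
      (bddAbove_Icc.mono (hs.trans hV₁.2.1)), ← range_comp]
    exact congrArg (fun f => sSup (range f)) (funext fun m => hφ (consEnv m e))

/-- If there is a strictly monotone map `h : V₁ → V₂`, continuous on `V₁`, with
`h 0 = 0` and `h 1 = 1`, then `G_{V₂} ⊆ G_{V₁}`. -/
theorem stmt14 (ar : ℕ → ℕ) (V₁ V₂ : Set ℝ)
    (hV₁ : GodelSet V₁) (hV₂ : GodelSet V₂)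
    (h : ℝ → ℝ) (hmap : ∀ x ∈ V₁, h x ∈ V₂)
    (hmono : ∀ x ∈ V₁, ∀ y ∈ V₁, x < y → h x < h y)
    (hcont : ContinuousOn h V₁) (h0 : h 0 = 0) (h1 : h 1 = 1) :
    GLogic ar V₂ ⊆ GLogic ar V₁ := by
  have hmono' : StrictMonoOn h V₁ := fun x hx y hy hxy => hmono x hx y hy hxy
  rintro φ ⟨hcl, hφ⟩
  refine ⟨hcl, (gNorm_eq_one_iff hV₁ φ).2 fun v => ?_⟩
  refine hmono'.injOn (geval_mem hV₁ v φ _) hV₁.2.2.2 ?_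
  rw [h1, ← geval_map hV₁ hmap hmono' hcont h0 h1]
  exact (gNorm_eq_one_iff hV₂ φ).1 hφ (v.map h hmap)
end
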